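/- Let k ∈ ℕ and let h : (0,∞) → (0,∞) be a gauge function such that h(2t) ≤ 4 h(t) for all t > 0 and ∫₀¹ t^{-1} |log t| √(t^{-1} h(t)) dt < ∞. Then there exists a compact set A ⊂ ℝ² and a constant C > 0 such that: (1) for each n ∈ ℕ, A can be covered by at most C / h(2^{-n}) balls of radius 2^{-n}; (2) 0 < ℋ^h(A) < ∞; and (3) every Borel set B ⊂ A with ℋ^h(B) > 0 is not 𝒫_k-tube null (in particular, A is not 𝒫_k-tube null). -/

import Mathlib

open MeasureTheory Metric Set
open scoped ENNReal NNReal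

noncomputable section

/-- `ℝ^d` as Euclidean space. -/
abbrev Pt (d : ℕ) := EuclideanSpace ℝ (Fin d)

/-- `L` is an affine line in `ℝ^d`. -/
def IsLine {d : ℕ} (L : Set (Pt d)) : Prop :=
  ∃ a v : Pt d, v ≠ 0 ∧ L = {x | ∃ t : ℝ, x = a + t • v}

/-- A tube of width `w` is the closed `w`-neighborhood of an affine line. -/
def IsTube {d : ℕ} (w : ℝ) (T : Set (Pt d)) : Prop :=
  ∃ L : Set (Pt d), IsLine L ∧ T = Metric.cthickening w L

/-- `A ⊆ ℝ^d` is tube null: for every `δ > 0` it is covered by countably many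
tubes `T j` of widths `w j` with `∑ j, (w j)^(d-1) ≤ δ`. -/
def TubeNull (d : ℕ) (A : Set (Pt d)) : Prop :=
  ∀ δ : ℝ, 0 < δ → ∃ (T : ℕ → Set (Pt d)) (w : ℕ → ℝ),
    (∀ n, 0 < w n ∧ IsTube (w n) (T n)) ∧ (A ⊆ ⋃ n, T n) ∧
    ∑' n, ENNReal.ofReal (w n) ^ (d - 1) ≤ ENNReal.ofReal δ

/-- The Hausdorff measure associated to the gauge function `h`. -/
def gMeasure {d : ℕ} (h : ℝ → ℝ) : Measure (Pt d) :=
  Measure.mkMetric (fun r : ℝ≥0∞ => ENNReal.ofReal (h r.toReal))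

/-- A (real) algebraic curve in `ℝ²` of degree at most `k`: the zero set of a
nonzero real polynomial in two variables of total degree at most `k`. -/
def IsAlgebraicCurve (k : ℕ) (γ : Set (Pt 2)) : Prop :=
  ∃ p : MvPolynomial (Fin 2) ℝ, p ≠ 0 ∧ p.totalDegree ≤ k ∧
    γ = {x : Pt 2 | MvPolynomial.eval (fun i => x i) p = 0}

/-- A `𝒫_k`-tube of width `w`: the closed `w`-neighborhood of an algebraic curve
of degree at most `k`. -/
def IsPkTube (k : ℕ) (w : ℝ) (T : Set (Pt 2)) : Prop :=
  ∃ γ : Set (Pt 2), IsAlgebraicCurve k γ ∧ T = Metric.cthickening w γ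

/-- `A ⊆ ℝ²` is `𝒫_k`-tube null. -/
def PkTubeNull (k : ℕ) (A : Set (Pt 2)) : Prop :=
  ∀ δ : ℝ, 0 < δ → ∃ (T : ℕ → Set (Pt 2)) (w : ℕ → ℝ),
    (∀ n, 0 < w n ∧ IsPkTube k (w n) (T n)) ∧ (A ⊆ ⋃ n, T n) ∧
    ∑' n, ENNReal.ofReal (w n) ≤ ENNReal.ofReal δ

section

open Polynomial

/-- Number of sign variations, in the sequence formed by a polynomial and its first `m`
derivatives at `t` (zero counts as negative). -/
def signVar : ℕ → ℝ[X] → ℝ → ℕ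
  | 0, _, _ => 0
  | m + 1, q, t =>
    (open Classical in if (0 < q.eval t ↔ 0 < (derivative q).eval t) then 0 else 1)
      + signVar m (derivative q) t

lemma signVar_le (m : ℕ) (q : ℝ[X]) (t : ℝ) : signVar m q t ≤ m := by
  induction m generalizing q with
  | zero => simp [signVar]
  | succ m ih =>
    have := ih (derivative q)
    simp only [signVar]
    split_ifs <;> omega

lemma eval_eq_of_natDegree_le_zero {q : ℝ[X]} (hq : q.natDegree ≤ 0) (a b : ℝ) :
    q.eval a = q.eval b := by
  rw [eq_C_of_natDegree_le_zero hq, eval_C, eval_C]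

lemma natDegree_derivative_le_of_le_succ {m : ℕ} {q : ℝ[X]} (hq : q.natDegree ≤ m + 1) :
    (derivative q).natDegree ≤ m :=
  (natDegree_derivative_le q).trans (by omega)

lemma signVar_parity {m : ℕ} {q : ℝ[X]} (hq : q.natDegree ≤ m) (a b : ℝ) :
    Even (signVar m q a + signVar m q b) ↔ (0 < q.eval a ↔ 0 < q.eval b) := by
  induction m generalizing q with
  | zero => simp [signVar, eval_eq_of_natDegree_le_zero hq a b]
  | succ m ih =>
    have h := ih (natDegree_derivative_le_of_le_succ hq)
    simp only [signVar]
    clear ih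
    rw [Nat.even_iff] at h ⊢
    by_cases h1 : 0 < q.eval a <;> by_cases h2 : 0 < q.eval b <;>
    by_cases h3 : 0 < (derivative q).eval a <;> by_cases h4 : 0 < (derivative q).eval b <;>
      simp only [h1, h2, h3, h4, iff_true, iff_false, not_true_eq_false,
        if_true, if_false] at h ⊢ <;> omega

lemma signVar_antitone_aux {m : ℕ} {q : ℝ[X]} (hq : q.natDegree ≤ m) {a b : ℝ} (hab : a ≤ b) :
    signVar m q b ≤ signVar m q a := by
  induction m generalizing q a b with
  | zero => simp [signVar]
  | succ m ih =>
    have hq' := natDegree_derivative_le_of_le_succ hq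
    have h := ih hq' hab
    rcases h.lt_or_eq with h | h
    · simp only [signVar]
      split_ifs <;> omega
    have hconst : ∀ t ∈ Icc a b,
        (0 < (derivative q).eval a ↔ 0 < (derivative q).eval t) := by
      intro t ht
      rw [← signVar_parity hq' a t]
      have h1 := ih hq' ht.1
      have h2 := ih hq' ht.2
      exact ⟨signVar m (derivative q) a, by omega⟩
    simp only [signVar]
    rw [h]
    have hb := hconst b ⟨hab, le_rfl⟩
    by_cases hd : 0 < (derivative q).eval a
    · have hm : MonotoneOn (fun x => q.eval x) (Icc a b) := by
        apply monotoneOn_of_deriv_nonneg (convex_Icc a b) q.continuous.continuousOn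
          q.differentiable.differentiableOn
        intro x hx
        rw [Polynomial.deriv]
        exact ((hconst x (interior_subset hx)).1 hd).le
      have hle : q.eval a ≤ q.eval b := hm ⟨le_rfl, hab⟩ ⟨hab, le_rfl⟩ hab
      have hd' := hb.1 hd
      simp only [hd, hd', iff_true, add_le_add_iff_right]
      by_cases h1 : 0 < q.eval a
      · simp [h1, h1.trans_le hle]
      · simp only [h1, if_false]; split_ifs <;> omega
    · have hm : AntitoneOn (fun x => q.eval x) (Icc a b) := by
        apply antitoneOn_of_deriv_nonpos (convex_Icc a b) q.continuous.continuousOn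
          q.differentiable.differentiableOn
        intro x hx
        rw [Polynomial.deriv]
        exact not_lt.1 fun h => hd ((hconst x (interior_subset hx)).2 h)
      have hle : q.eval b ≤ q.eval a := hm ⟨le_rfl, hab⟩ ⟨hab, le_rfl⟩ hab
      have hd' : ¬ 0 < (derivative q).eval b := fun h => hd (hb.2 h)
      simp only [hd, hd', iff_false, add_le_add_iff_right]
      by_cases h1 : 0 < q.eval b
      · simp [h1, h1.trans_le hle]
      · simp [h1]

lemma signVar_antitone {m : ℕ} {q : ℝ[X]} (hq : q.natDegree ≤ m) :
    Antitone (signVar m q) := fun _ _ hab => signVar_antitone_aux hq hab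

lemma signVar_C_mul (m : ℕ) {c : ℝ} (hc : 0 < c) (q : ℝ[X]) (t : ℝ) :
    signVar m (C c * q) t = signVar m q t := by
  induction m generalizing q with
  | zero => simp [signVar]
  | succ m ih => simp [signVar, ih, mul_pos_iff_of_pos_left hc]

lemma signVar_comp (m : ℕ) {c : ℝ} (hc : 0 < c) (d : ℝ) (q : ℝ[X]) (t : ℝ) :
    signVar m (q.comp (C c * X + C d)) t = signVar m q (c * t + d) := by
  induction m generalizing q with
  | zero => simp [signVar]
  | succ m ih =>
    have h : derivative (q.comp (C c * X + C d))
        = C c * (derivative q).comp (C c * X + C d) := by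
      rw [derivative_comp]; simp
    simp only [signVar]
    rw [h, signVar_C_mul m hc, ih]
    simp [mul_pos_iff_of_pos_left hc]

/-- If the number of sign variations is constant on `[-R, R]`, the polynomial is bounded by
its value at `0` on one of the two halves. -/
lemma abs_eval_le_of_signVar_eq {m : ℕ} {q : ℝ[X]} (hq : q.natDegree ≤ m) {R : ℝ} (hR : 0 ≤ R)
    (hV : signVar m q (-R) = signVar m q R) :
    (∀ t ∈ Icc 0 R, |q.eval t| ≤ |q.eval 0|) ∨ (∀ t ∈ Icc (-R) 0, |q.eval t| ≤ |q.eval 0|) := by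
  have hall : ∀ t ∈ Icc (-R) R, signVar m q t = signVar m q R := fun t ht =>
    le_antisymm ((signVar_antitone hq ht.1).trans hV.le) (signVar_antitone hq ht.2)
  have h0 : (0 : ℝ) ∈ Icc (-R) R := ⟨by linarith, hR⟩
  have hs : ∀ t ∈ Icc (-R) R, (0 < q.eval 0 ↔ 0 < q.eval t) := by
    intro t ht
    rw [← signVar_parity hq 0 t, hall t ht, hall 0 h0]
    exact ⟨_, rfl⟩
  cases m with
  | zero =>
    left; intro t _
    rw [eval_eq_of_natDegree_le_zero hq t 0]
  | succ m =>
    have hq' := natDegree_derivative_le_of_le_succ hq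
    have hvar : ∀ s t, s ∈ Icc (-R) R → t ∈ Icc (-R) R → s ≤ t →
        (0 < q.eval t ↔ 0 < (derivative q).eval t) →
        (0 < q.eval s ↔ 0 < (derivative q).eval s) := by
      intro s t hs ht hst h
      have e : signVar (m+1) q s = signVar (m+1) q t := (hall s hs).trans (hall t ht).symm
      have := signVar_antitone hq' hst
      simp only [signVar, h, if_true] at e
      by_contra hcon
      rw [if_neg hcon] at e
      omega
    have hder : ∀ x, deriv (fun x => q.eval x) x = (derivative q).eval x := fun x =>
      Polynomial.deriv q
    by_cases hcase : (0 < q.eval 0 ↔ 0 < (derivative q).eval 0)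
    · right
      intro t ht
      have hsub : ∀ x ∈ Icc (-R) 0, x ∈ Icc (-R) R := fun x hx => ⟨hx.1, hx.2.trans hR⟩
      have hsign : ∀ x ∈ Icc (-R) 0, (0 < q.eval 0 ↔ 0 < (derivative q).eval x) := fun x hx =>
        (hs x (hsub x hx)).trans (hvar x 0 (hsub x hx) h0 hx.2 hcase)
      have ht0 := hs t (hsub t ht)
      have hz : (0:ℝ) ∈ Icc (-R) 0 := ⟨by linarith, le_rfl⟩
      by_cases hp : 0 < q.eval 0
      · have hm : MonotoneOn (fun x => q.eval x) (Icc (-R) 0) := by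
          apply monotoneOn_of_deriv_nonneg (convex_Icc _ _) q.continuous.continuousOn
            q.differentiable.differentiableOn
          intro x hx
          rw [hder]
          exact ((hsign x (interior_subset hx)).1 hp).le
        have hle : q.eval t ≤ q.eval 0 := hm ht hz ht.2
        rw [abs_of_pos hp, abs_of_pos (ht0.1 hp)]
        exact hle
      · have hm : AntitoneOn (fun x => q.eval x) (Icc (-R) 0) := by
          apply antitoneOn_of_deriv_nonpos (convex_Icc _ _) q.continuous.continuousOn
            q.differentiable.differentiableOn
          intro x hx
          rw [hder]
          exact not_lt.1 fun h => hp ((hsign x (interior_subset hx)).2 h)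
        have hle : q.eval 0 ≤ q.eval t := hm ht hz ht.2
        have h2 : q.eval t ≤ 0 := not_lt.1 fun h => hp (ht0.2 h)
        rw [abs_of_nonpos h2, abs_of_nonpos (not_lt.1 hp)]
        linarith
    · left
      intro t ht
      have hsub : ∀ x ∈ Icc 0 R, x ∈ Icc (-R) R := fun x hx => ⟨by linarith [hx.1], hx.2⟩
      have hsign : ∀ x ∈ Icc 0 R, (0 < q.eval 0 ↔ ¬ 0 < (derivative q).eval x) := by
        intro x hx
        have h1 := hs x (hsub x hx)
        have h2 := mt (hvar 0 x h0 (hsub x hx) hx.1) hcase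
        tauto
      have ht0 := hs t (hsub t ht)
      have hz : (0:ℝ) ∈ Icc 0 R := ⟨le_rfl, hR⟩
      by_cases hp : 0 < q.eval 0
      · have hm : AntitoneOn (fun x => q.eval x) (Icc 0 R) := by
          apply antitoneOn_of_deriv_nonpos (convex_Icc _ _) q.continuous.continuousOn
            q.differentiable.differentiableOn
          intro x hx
          rw [hder]
          exact not_lt.1 ((hsign x (interior_subset hx)).1 hp)
        have hle : q.eval t ≤ q.eval 0 := hm hz ht ht.1
        rw [abs_of_pos hp, abs_of_pos (ht0.1 hp)]
        exact hle
      · have hm : MonotoneOn (fun x => q.eval x) (Icc 0 R) := by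
          apply monotoneOn_of_deriv_nonneg (convex_Icc _ _) q.continuous.continuousOn
            q.differentiable.differentiableOn
          intro x hx
          rw [hder]
          by_contra hneg
          exact hp ((hsign x (interior_subset hx)).2 fun h => hneg h.le)
        have hle : q.eval 0 ≤ q.eval t := hm hz ht ht.1
        have h2 : q.eval t ≤ 0 := not_lt.1 fun h => hp (ht0.2 h)
        rw [abs_of_nonpos h2, abs_of_nonpos (not_lt.1 hp)]
        linarith

/-- Lagrange interpolation at the nodes `0, …, k`. -/
lemma eval_eq_sum_lagrange {k : ℕ} {q : ℝ[X]} (hq : q.natDegree ≤ k) (t : ℝ) :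
    q.eval t = ∑ i ∈ Finset.range (k + 1), q.eval (i : ℝ) *
      (Lagrange.basis (Finset.range (k + 1)) (fun i : ℕ => (i : ℝ)) i).eval t := by
  have hinj : Set.InjOn (fun i : ℕ => (i : ℝ)) (Finset.range (k + 1)) :=
    fun a _ b _ h => Nat.cast_injective h
  have hdeg : q.degree < (Finset.range (k + 1)).card := by
    rw [Finset.card_range]
    exact degree_le_natDegree.trans_lt (by exact_mod_cast Nat.lt_succ_of_le hq)
  conv_lhs => rw [Lagrange.eq_interpolate hinj hdeg]
  rw [Lagrange.interpolate_apply, eval_finsetSum]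
  simp

/-- Near-constancy of polynomials that are bounded by their value at `0` on one side. -/
lemma exists_near_const (k : ℕ) {δ : ℝ} (hδ : 0 < δ) : ∃ ε > 0, ∀ q : ℝ[X], q.natDegree ≤ k →
    ∀ R : ℝ, R ≠ 0 → (∀ u ∈ Icc (0:ℝ) 1, |q.eval (R * u)| ≤ |q.eval 0|) →
    ∀ t, |t| ≤ ε * |R| → |q.eval t - q.eval 0| ≤ δ * |q.eval 0| := by
  set ℓ : ℕ → ℝ[X] := fun i =>
    Lagrange.basis (Finset.range (k + 1)) (fun i : ℕ => (i : ℝ)) i with hℓ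
  have hcont : Continuous fun s : ℝ => ∑ i ∈ Finset.range (k + 1),
      |(ℓ i).eval s - (ℓ i).eval 0| := by
    refine continuous_finsetSum _ fun i _ => ?_
    exact ((ℓ i).continuous.sub continuous_const).abs
  obtain ⟨ε, hε, hball⟩ := Metric.continuousAt_iff.1 (hcont.continuousAt (x := 0)) δ hδ
  refine ⟨ε / (2 * (k + 1)), by positivity, fun q hq R hR hb t ht => ?_⟩
  have hk : (0:ℝ) < k + 1 := by positivity
  set q' := q.comp (C (R / (k + 1)) * X) with hq'
  have hdeg : q'.natDegree ≤ k := by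
    refine natDegree_comp_le.trans ?_
    have : (C (R / ((k:ℝ) + 1)) * X : ℝ[X]).natDegree ≤ 1 := by compute_degree
    nlinarith
  have hev : ∀ s, q'.eval s = q.eval (R / (k + 1) * s) := by intro s; simp [hq']
  set s := t * (k + 1) / R with hs
  have hst : R / (k + 1) * s = t := by rw [hs]; field_simp
  have h1 : q.eval t - q.eval 0 = ∑ i ∈ Finset.range (k + 1), q'.eval (i : ℝ) *
      ((ℓ i).eval s - (ℓ i).eval 0) := by
    have e1 := eval_eq_sum_lagrange hdeg s
    have e2 := eval_eq_sum_lagrange hdeg 0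
    rw [hev s, hst] at e1
    rw [hev 0, mul_zero] at e2
    rw [e1, e2, ← Finset.sum_sub_distrib]
    simp only [mul_sub, hℓ]
  have hsmall : |s| < ε := by
    have hRp : 0 < |R| := abs_pos.2 hR
    rw [hs, abs_div, abs_mul, abs_of_pos hk, div_lt_iff₀ hRp]
    calc |t| * (k + 1) ≤ ε / (2 * (k + 1)) * |R| * (k + 1) := by gcongr
      _ = ε * |R| / 2 := by field_simp
      _ < ε * |R| := half_lt_self (by positivity)
  have h2 := hball (x := s) (by simpa [Real.dist_eq] using hsmall)
  rw [Real.dist_eq] at h2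
  simp only [sub_self, abs_zero, Finset.sum_const_zero, sub_zero] at h2
  calc |q.eval t - q.eval 0| ≤ ∑ i ∈ Finset.range (k + 1), |q.eval 0| *
        |(ℓ i).eval s - (ℓ i).eval 0| := by
        rw [h1]
        refine (Finset.abs_sum_le_sum_abs _ _).trans (Finset.sum_le_sum fun i hi => ?_)
        rw [abs_mul]
        refine mul_le_mul_of_nonneg_right ?_ (abs_nonneg _)
        rw [hev, div_mul_eq_mul_div, mul_div_assoc]
        refine hb _ ⟨by positivity, ?_⟩
        rw [div_le_one hk]
        have := Finset.mem_range.1 hi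
        exact_mod_cast this.le
    _ = (∑ i ∈ Finset.range (k + 1), |(ℓ i).eval s - (ℓ i).eval 0|) * |q.eval 0| := by
        rw [← Finset.mul_sum, mul_comm]
    _ ≤ δ * |q.eval 0| := by
        gcongr
        exact (le_abs_self _).trans h2.le

/-- Polynomials with a constant number of sign variations on a long interval are nearly
constant around its centre. -/
lemma exists_near_const_of_signVar (k : ℕ) {δ : ℝ} (hδ : 0 < δ) (ρ : ℝ) :
    ∃ R : ℕ, ∀ q : ℝ[X], q.natDegree ≤ k → ∀ R' : ℕ, R ≤ R' →
      signVar k q (-(R' : ℝ)) = signVar k q R' →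
      ∀ t, |t| ≤ ρ → |q.eval t - q.eval 0| ≤ δ * |q.eval 0| := by
  obtain ⟨ε, hε, h⟩ := exists_near_const k hδ
  obtain ⟨R, hR⟩ := exists_nat_gt (|ρ| / ε)
  refine ⟨R, fun q hq R' hRR hV t ht => ?_⟩
  have hRR' : (R : ℝ) ≤ R' := by exact_mod_cast hRR
  have hpos : 0 < (R' : ℝ) := lt_of_lt_of_le (lt_of_le_of_lt (by positivity) hR) hRR'
  have ht' : |t| ≤ ε * R' := by
    rw [div_lt_iff₀ hε] at hR
    nlinarith [le_abs_self ρ]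
  rcases abs_eval_le_of_signVar_eq hq hpos.le hV with h1 | h1
  · refine h q hq R' hpos.ne' (fun u hu => h1 _ ⟨?_, ?_⟩) t (by rwa [abs_of_pos hpos])
    · exact mul_nonneg hpos.le hu.1
    · exact mul_le_of_le_one_right hpos.le hu.2
  · refine h q hq (-R') (neg_ne_zero.2 hpos.ne') (fun u hu => h1 _ ⟨?_, ?_⟩) t
      (by rwa [abs_neg, abs_of_pos hpos])
    · nlinarith [hu.2]
    · nlinarith [hu.1]

/-- The polynomial representing a polynomial function (`0` if there is none). -/
def slice (g : ℝ → ℝ) : ℝ[X] :=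
  open Classical in if h : ∃ q : ℝ[X], g = fun y => q.eval y then h.choose else 0

lemma slice_eval (q : ℝ[X]) : slice (fun y => q.eval y) = q := by
  have h : ∃ q' : ℝ[X], (fun y => q.eval y) = fun y => q'.eval y := ⟨q, rfl⟩
  rw [slice, dif_pos h]
  exact Polynomial.funext fun y => (congrFun h.choose_spec y).symm

/-- Sign variations of a polynomial function. -/
def fnVar (k : ℕ) (g : ℝ → ℝ) (t : ℝ) : ℕ := signVar k (slice g) t

lemma fnVar_eval (k : ℕ) (q : ℝ[X]) (t : ℝ) : fnVar k (fun y => q.eval y) t = signVar k q t := by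
  rw [fnVar, slice_eval]

/-- `g` is a polynomial function of degree at most `k`. -/
def IsPolyFn (k : ℕ) (g : ℝ → ℝ) : Prop := ∃ q : ℝ[X], q.natDegree ≤ k ∧ g = fun y => q.eval y

lemma IsPolyFn.antitone_fnVar {k : ℕ} {g : ℝ → ℝ} (hg : IsPolyFn k g) : Antitone (fnVar k g) := by
  obtain ⟨q, hq, rfl⟩ := hg
  intro a b hab
  simp only [fnVar_eval]
  exact signVar_antitone hq hab

lemma fnVar_le (k : ℕ) (g : ℝ → ℝ) (t : ℝ) : fnVar k g t ≤ k := signVar_le _ _ _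

lemma IsPolyFn.comp_affine {k : ℕ} {g : ℝ → ℝ} (hg : IsPolyFn k g) (c d : ℝ) :
    IsPolyFn k fun y => g (c * y + d) := by
  obtain ⟨q, hq, rfl⟩ := hg
  refine ⟨q.comp (C c * X + C d), natDegree_comp_le.trans ?_, by ext; simp⟩
  have : (C c * X + C d : ℝ[X]).natDegree ≤ 1 := by compute_degree
  nlinarith

lemma IsPolyFn.fnVar_comp_affine {k : ℕ} {g : ℝ → ℝ} (hg : IsPolyFn k g) {c : ℝ} (hc : 0 < c)
    (d t : ℝ) : fnVar k (fun y => g (c * y + d)) t = fnVar k g (c * t + d) := by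
  obtain ⟨q, hq, rfl⟩ := hg
  have : (fun y => q.eval (c * y + d)) = fun y => (q.comp (C c * X + C d)).eval y := by
    ext; simp
  rw [this, fnVar_eval, fnVar_eval, signVar_comp k hc]

/-- Functions of two variables that are polynomials of degree at most `k` in each variable. -/
def Bi (k : ℕ) (f : ℝ → ℝ → ℝ) : Prop :=
  (∀ x, IsPolyFn k (f x)) ∧ ∀ y, IsPolyFn k fun x => f x y

lemma Bi.flip {k : ℕ} {f : ℝ → ℝ → ℝ} (hf : Bi k f) : Bi k (flip f) := ⟨hf.2, hf.1⟩

lemma Bi.affine {k : ℕ} {f : ℝ → ℝ → ℝ} (hf : Bi k f) (c d e : ℝ) :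
    Bi k fun x y => f (c * x + d) (c * y + e) :=
  ⟨fun x => (hf.1 (c * x + d)).comp_affine c e, fun y => (hf.2 (c * y + e)).comp_affine c d⟩

lemma Bi.shift {k : ℕ} {f : ℝ → ℝ → ℝ} (hf : Bi k f) (d e : ℝ) :
    Bi k fun x y => f (x + d) (y + e) := by
  simpa using hf.affine 1 d e

/-- Drop of the number of sign variations along the left edge of a square. -/
def dv (k : ℕ) (f : ℝ → ℝ → ℝ) (p : ℕ × ℕ) : ℕ :=
  fnVar k (f p.1) p.2 - fnVar k (f p.1) (p.2 + 1)

/-- Drop of the number of sign variations along the bottom edge of a square. -/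
def dh (k : ℕ) (f : ℝ → ℝ → ℝ) (p : ℕ × ℕ) : ℕ := dv k (flip f) p.swap

lemma dv_le (k : ℕ) (f : ℝ → ℝ → ℝ) (p : ℕ × ℕ) : dv k f p ≤ k :=
  (Nat.sub_le _ _).trans (fnVar_le _ _ _)

lemma dh_le (k : ℕ) (f : ℝ → ℝ → ℝ) (p : ℕ × ℕ) : dh k f p ≤ k := dv_le _ _ _

/-- The `c`-th dyadic child of a square. -/
def child (p : ℕ × ℕ) (c : Fin 2 × Fin 2) : ℕ × ℕ := (2 * p.1 + c.1, 2 * p.2 + c.2)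

lemma swap_child (p : ℕ × ℕ) (c : Fin 2 × Fin 2) : (child p c).swap = child p.swap c.swap := rfl

lemma sum_dv_child {k : ℕ} {f : ℝ → ℝ → ℝ} (hf : Bi k f) (p : ℕ × ℕ) :
    ∑ c, dv k f (child p c) = dv k (fun x y => f (2 * x + 0) (2 * y + 0)) p +
      dv k (fun x y => f (2 * x + 1) (2 * y + 0)) p := by
  have key : ∀ a : ℝ, dv k (fun x y => f (2 * x + a) (2 * y + 0)) p =
      (fnVar k (f (2 * p.1 + a)) (2 * p.2) - fnVar k (f (2 * p.1 + a)) (2 * p.2 + 1)) +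
      (fnVar k (f (2 * p.1 + a)) (2 * p.2 + 1) - fnVar k (f (2 * p.1 + a)) (2 * p.2 + 1 + 1)) := by
    intro a
    have hg := hf.1 (2 * p.1 + a)
    simp only [dv]
    rw [hg.fnVar_comp_affine two_pos, hg.fnVar_comp_affine two_pos]
    have h1 := hg.antitone_fnVar (show (2 * p.2 : ℝ) ≤ 2 * p.2 + 1 by linarith)
    have h2 := hg.antitone_fnVar (show (2 * p.2 + 1 : ℝ) ≤ 2 * p.2 + 1 + 1 by linarith)
    rw [show (2 * p.2 + 0 : ℝ) = 2 * p.2 by ring,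
      show (2 * (p.2 + 1) + 0 : ℝ) = 2 * p.2 + 1 + 1 by ring]
    omega
  rw [key, key, Fintype.sum_prod_type]
  simp [Fin.sum_univ_two, dv, child]

lemma sum_dh_child {k : ℕ} {f : ℝ → ℝ → ℝ} (hf : Bi k f) (p : ℕ × ℕ) :
    ∑ c, dh k f (child p c) = dh k (fun x y => f (2 * x + 0) (2 * y + 0)) p +
      dh k (fun x y => f (2 * x + 0) (2 * y + 1)) p := by
  have := sum_dv_child hf.flip p.swap
  simp only [dh, swap_child]
  rw [← Equiv.sum_comp (Equiv.prodComm (Fin 2) (Fin 2))] at this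
  exact this

lemma Bi.eq_sum {k : ℕ} {f : ℝ → ℝ → ℝ} (hf : Bi k f) (x y : ℝ) :
    f x y = ∑ i ∈ Finset.range (k + 1), f x i *
      (Lagrange.basis (Finset.range (k + 1)) (fun i : ℕ => (i : ℝ)) i).eval y := by
  obtain ⟨q, hq, h⟩ := hf.1 x
  rw [h]
  exact eval_eq_sum_lagrange hq y

lemma exists_near_const_of_fnVar (k : ℕ) {δ : ℝ} (hδ : 0 < δ) (ρ : ℝ) :
    ∃ R : ℕ, ∀ g : ℝ → ℝ, IsPolyFn k g → fnVar k g (-(R : ℝ)) = fnVar k g R →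
      ∀ t, |t| ≤ ρ → |g t - g 0| ≤ δ * |g 0| := by
  obtain ⟨R, hR⟩ := exists_near_const_of_signVar k hδ ρ
  refine ⟨R, fun g hg h => ?_⟩
  obtain ⟨q, hq, rfl⟩ := hg
  simp only [fnVar_eval] at h
  exact hR q hq R le_rfl h

lemma exists_radius_zero (k : ℕ) : ∃ R : ℕ, ∀ f, Bi k f →
    fnVar k (f 0) (-(R : ℝ)) = fnVar k (f 0) R →
    (∀ l ∈ Finset.range (k + 1), fnVar k (fun x => f x l) (-(R : ℝ)) = fnVar k (fun x => f x l) R) →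
    ∀ x y, |x| ≤ 3 → |y| ≤ 3 → f x y = 0 → ∀ x y, f x y = 0 := by
  set ℓ : ℕ → ℝ[X] := fun i =>
    Lagrange.basis (Finset.range (k + 1)) (fun i : ℕ => (i : ℝ)) i with hℓ
  have hcont : Continuous fun s : ℝ => ∑ i ∈ Finset.range (k + 1), |(ℓ i).eval s| :=
    continuous_finsetSum _ fun i _ => (ℓ i).continuous.abs
  obtain ⟨Λ, hΛ⟩ := (isCompact_Icc (a := (-3 : ℝ)) (b := 3)).bddAbove_image hcont.continuousOn
  have hΛ' : ∀ y, |y| ≤ 3 → ∑ i ∈ Finset.range (k + 1), |(ℓ i).eval y| ≤ Λ := fun y hy =>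
    hΛ ⟨y, abs_le.1 hy, rfl⟩
  have hΛ0 : 0 ≤ Λ := (Finset.sum_nonneg fun _ _ => abs_nonneg _).trans (hΛ' 0 (by simp))
  set δ : ℝ := 1 / (2 * (2 * Λ + 1)) with hδ
  have hδ0 : 0 < δ := by positivity
  have hδ1 : δ * (2 * Λ + 1) = 1 / 2 := by rw [hδ]; field_simp
  have hδ2 : δ ≤ 1 := by nlinarith
  obtain ⟨R, hR⟩ := exists_near_const_of_fnVar k hδ0 (3 + k)
  refine ⟨R, fun f hf hv hh x y hx hy hxy => ?_⟩
  set P := f 0 0 with hP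
  have h0 : ∀ y : ℝ, |y| ≤ 3 + k → |f 0 y - P| ≤ δ * |P| := hR _ (hf.1 0) hv
  have h1 : ∀ l ∈ Finset.range (k + 1), ∀ x, |x| ≤ 3 → |f x l - f 0 l| ≤ δ * |f 0 l| :=
    fun l hl x hx => hR _ (hf.2 l) (hh l hl) x (by linarith [(Nat.cast_nonneg k : (0:ℝ) ≤ k)])
  have hl0 : ∀ l ∈ Finset.range (k + 1), |f 0 l| ≤ 2 * |P| := by
    intro l hl
    have hlk : (l : ℝ) ≤ k := by exact_mod_cast Nat.lt_succ_iff.1 (Finset.mem_range.1 hl)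
    have := h0 l (by rw [abs_of_nonneg (Nat.cast_nonneg l)]; linarith)
    have h3 := abs_sub_abs_le_abs_sub (f 0 l) P
    nlinarith [abs_nonneg P]
  have hd : |f x y - f 0 y| ≤ Λ * (δ * (2 * |P|)) := by
    rw [hf.eq_sum x y, hf.eq_sum 0 y, ← Finset.sum_sub_distrib]
    calc _ ≤ ∑ i ∈ Finset.range (k + 1), |(ℓ i).eval y| * (δ * (2 * |P|)) := by
          refine (Finset.abs_sum_le_sum_abs _ _).trans (Finset.sum_le_sum fun i hi => ?_)
          rw [← sub_mul, abs_mul, mul_comm]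
          refine mul_le_mul_of_nonneg_left ((h1 i hi x hx).trans ?_) (abs_nonneg _)
          exact mul_le_mul_of_nonneg_left (hl0 i hi) hδ0.le
      _ = (∑ i ∈ Finset.range (k + 1), |(ℓ i).eval y|) * (δ * (2 * |P|)) := by
          rw [Finset.sum_mul]
      _ ≤ _ := mul_le_mul_of_nonneg_right (hΛ' y hy) (by positivity)
  have hP0 : P = 0 := by
    have h2 := h0 y (by linarith [(Nat.cast_nonneg k : (0:ℝ) ≤ k)])
    rw [hxy, zero_sub, abs_neg] at hd
    have h3 := abs_sub_abs_le_abs_sub P (f 0 y)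
    rw [abs_sub_comm] at h3
    have : |P| ≤ δ * (2 * Λ + 1) * |P| := by nlinarith
    rw [hδ1] at this
    exact abs_eq_zero.1 (le_antisymm (by linarith) (abs_nonneg P))
  have hzero : ∀ l ∈ Finset.range (k + 1), ∀ x, f x l = 0 := by
    intro l hl
    have hl' : f 0 l = 0 := by simpa [hP0] using hl0 l hl
    have hsm : ∀ x, |x| ≤ 3 → f x l = 0 := fun x hx => by simpa [hl'] using h1 l hl x hx
    obtain ⟨q, hq, e⟩ := hf.2 l
    have hq0 : q = 0 := by
      refine Polynomial.eq_zero_of_infinite_isRoot q ((Icc_infinite (show (-3:ℝ) < 3 by norm_num)).mono ?_)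
      intro x hx
      have := hsm x (abs_le.2 hx)
      rw [show f x l = q.eval x from congrFun e x] at this
      exact this
    intro x
    rw [show f x l = q.eval x from congrFun e x, hq0, eval_zero]
  intro x y
  rw [hf.eq_sum]
  exact Finset.sum_eq_zero fun i hi => by rw [hzero i hi, zero_mul]

lemma exists_radius (k : ℕ) : ∃ R : ℕ, ∀ f, Bi k f → ∀ i j : ℝ,
    fnVar k (f i) (j - R) = fnVar k (f i) (j + R) →
    (∀ l ∈ Finset.range (k + 1),
      fnVar k (fun x => f x (j + l)) (i - R) = fnVar k (fun x => f x (j + l)) (i + R)) →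
    ∀ x y, |x - i| ≤ 3 → |y - j| ≤ 3 → f x y = 0 → ∀ x y, f x y = 0 := by
  obtain ⟨R, hR⟩ := exists_radius_zero k
  refine ⟨R, fun f hf i j hv hh x y hx hy h0 => ?_⟩
  have shift : ∀ g, IsPolyFn k g → ∀ d t, fnVar k (fun y => g (y + d)) t = fnVar k g (t + d) := by
    intro g hg d t
    simpa using hg.fnVar_comp_affine one_pos d t
  have := hR _ (hf.shift i j) ?_ ?_ (x - i) (y - j) hx hy (by simpa using h0)
  · intro x y
    simpa using this (x - i) (y - j)
  · rw [shift _ (hf.1 _), shift _ (hf.1 _)]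
    simpa [add_comm, sub_eq_add_neg] using hv
  · intro l hl
    have := hh l hl
    rw [shift _ (hf.2 _), shift _ (hf.2 _)]
    simpa [add_comm, sub_eq_add_neg] using this

lemma sum_range_antitone_sub {u : ℕ → ℕ} (hu : Antitone u) (n : ℕ) :
    ∑ r ∈ Finset.range n, (u r - u (r + 1)) = u 0 - u n := by
  induction n with
  | zero => simp
  | succ n ih =>
    rw [Finset.sum_range_succ, ih]
    have h1 : u n ≤ u 0 := hu (Nat.zero_le n)
    have h2 : u (n + 1) ≤ u n := hu n.le_succ
    omega

lemma sum_dv_shift {k : ℕ} {f : ℝ → ℝ → ℝ} (hf : Bi k f) (p : ℕ × ℕ) (a b : ℝ) (R : ℕ) :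
    ∑ r ∈ Finset.range (2 * R), dv k (fun x y => f (x + a) (y + (b + (r - R)))) p =
      fnVar k (f (p.1 + a)) (p.2 + b - R) - fnVar k (f (p.1 + a)) (p.2 + b + R) := by
  have hg := hf.1 (p.1 + a)
  have hu : Antitone fun r : ℕ => fnVar k (f (p.1 + a)) (p.2 + b - R + r) := by
    intro r s hrs
    refine hg.antitone_fnVar ?_
    have : (r : ℝ) ≤ s := by exact_mod_cast hrs
    linarith
  have shift : ∀ d t, fnVar k (fun y => f (p.1 + a) (y + d)) t = fnVar k (f (p.1 + a)) (t + d) := by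
    intro d t
    simpa using hg.fnVar_comp_affine one_pos d t
  have := sum_range_antitone_sub hu (2 * R)
  simp only [Nat.cast_zero, add_zero] at this
  rw [show (p.2 + b + R : ℝ) = p.2 + b - R + (2 * R : ℕ) by push_cast; ring, ← this]
  refine Finset.sum_congr rfl fun r _ => ?_
  simp only [dv]
  rw [shift, shift]
  push_cast
  congr 2 <;> ring

lemma sum_dh_shift {k : ℕ} {f : ℝ → ℝ → ℝ} (hf : Bi k f) (p : ℕ × ℕ) (b : ℝ) (R : ℕ) :
    ∑ r ∈ Finset.range (2 * R), dh k (fun x y => f (x + (r - R)) (y + b)) p =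
      fnVar k (fun x => f x (p.2 + b)) (p.1 - R) - fnVar k (fun x => f x (p.2 + b)) (p.1 + R) := by
  have := sum_dv_shift hf.flip p.swap b 0 R
  simp only [zero_add, add_zero] at this
  exact this

lemma exists_one_le_sum (k : ℕ) : ∃ R : ℕ, ∀ f, Bi k f → (∃ x y, f x y ≠ 0) →
    ∀ p : ℕ × ℕ, (∃ x y : ℝ, |x - p.1| ≤ 3 ∧ |y - p.2| ≤ 3 ∧ f x y = 0) →
    1 ≤ ∑ r ∈ Finset.range (2 * R), dv k (fun x y => f (x + 0) (y + (0 + (r - R)))) p +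
      ∑ l ∈ Finset.range (k + 1), ∑ r ∈ Finset.range (2 * R),
        dh k (fun x y => f (x + (r - R)) (y + l)) p := by
  obtain ⟨R, hR⟩ := exists_radius k
  refine ⟨R, fun f hf ⟨x₀, y₀, h₀⟩ p ⟨x, y, hx, hy, h0⟩ => ?_⟩
  by_contra hlt
  have hlt : ∑ r ∈ Finset.range (2 * R), dv k (fun x y => f (x + 0) (y + (0 + (r - R)))) p +
      ∑ l ∈ Finset.range (k + 1), ∑ r ∈ Finset.range (2 * R),
        dh k (fun x y => f (x + (r - R)) (y + l)) p = 0 := by omega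
  obtain ⟨e1, e2⟩ := Nat.add_eq_zero_iff.1 hlt
  rw [sum_dv_shift hf] at e1
  rw [Finset.sum_eq_zero_iff] at e2
  have hRR : ∀ t : ℝ, t - R ≤ t + R := fun t => by
    linarith [(Nat.cast_nonneg R : (0:ℝ) ≤ R)]
  refine h₀ (hR f hf p.1 p.2 ?_ ?_ x y hx hy h0 x₀ y₀)
  · have := (hf.1 p.1).antitone_fnVar (hRR p.2)
    simp only [add_zero] at e1
    omega
  · intro l hl
    have h2 := e2 l hl
    rw [sum_dh_shift hf] at h2
    have := (hf.2 (p.2 + l)).antitone_fnVar (hRR p.1)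
    omega

lemma vcDim_positivity_le {ι κ : Type*} [Fintype ι] [DecidableEq ι] [Fintype κ]
    (v : ι → κ → ℝ) (𝒜 : Finset (Finset ι))
    (h𝒜 : ∀ S ∈ 𝒜, ∃ c : κ → ℝ, ∀ i, i ∈ S ↔ 0 < v i ⬝ᵥ c) : 𝒜.vcDim ≤ Fintype.card κ := by
  refine Finset.sup_le fun T hT => ?_
  rw [Finset.mem_shatterer] at hT
  by_contra! hcard
  have hdep : ¬ LinearIndependent ℝ fun t : T => v t := by
    intro hli
    have := hli.fintype_card_le_finrank
    simp at this
    omega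
  obtain ⟨g, hg, t₀, ht₀⟩ := Fintype.not_linearIndependent_iff.1 hdep
  obtain ⟨g, hg, t₀, ht₀⟩ : ∃ g : T → ℝ, ∑ t, g t • v t = 0 ∧ ∃ t₀, 0 < g t₀ := by
    rcases lt_or_gt_of_ne ht₀ with h | h
    · exact ⟨-g, by simpa using hg, t₀, by simpa using h⟩
    · exact ⟨g, hg, t₀, h⟩
  obtain ⟨S, hS, hTS⟩ := hT (t := T.filter fun t => ∃ h : t ∈ T, 0 < g ⟨t, h⟩)
    (Finset.filter_subset _ _)
  obtain ⟨c, hc⟩ := h𝒜 S hS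
  have hiff : ∀ t : T, 0 < v t ⬝ᵥ c ↔ 0 < g t := by
    intro t
    rw [← hc]
    have := Finset.ext_iff.1 hTS t
    simpa [t.2] using this
  have hzero : ∑ t : T, g t * (v t ⬝ᵥ c) = 0 := by
    have := congrArg (· ⬝ᵥ c) hg
    simpa [sum_dotProduct] using this
  refine absurd hzero (Finset.sum_pos' (fun t _ => ?_) ⟨t₀, Finset.mem_univ _, ?_⟩).ne'
  · by_cases h : 0 < g t
    · exact (mul_pos h ((hiff t).2 h)).le
    · exact mul_nonneg_of_nonpos_of_nonpos (not_lt.1 h) (not_lt.1 fun h' => h ((hiff t).1 h'))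
  · exact mul_pos ht₀ ((hiff t₀).2 ht₀)

lemma card_positivity_le {ι κ : Type*} [Fintype ι] [Nonempty ι] [DecidableEq ι] [Fintype κ]
    (v : ι → κ → ℝ) (𝒜 : Finset (Finset ι))
    (h𝒜 : ∀ S ∈ 𝒜, ∃ c : κ → ℝ, ∀ i, i ∈ S ↔ 0 < v i ⬝ᵥ c) :
    𝒜.card ≤ (Fintype.card κ + 1) * Fintype.card ι ^ Fintype.card κ := by
  have hd := vcDim_positivity_le v 𝒜 h𝒜
  refine (𝒜.card_le_card_shatterer.trans Finset.card_shatterer_le_sum_vcDim).trans ?_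
  have hι : 1 ≤ Fintype.card ι := Fintype.card_pos
  calc ∑ k ∈ Finset.Iic 𝒜.vcDim, (Fintype.card ι).choose k
      ≤ ∑ k ∈ Finset.Iic (Fintype.card κ), (Fintype.card ι).choose k :=
        Finset.sum_le_sum_of_subset (Finset.Iic_subset_Iic.2 hd)
    _ ≤ ∑ k ∈ Finset.Iic (Fintype.card κ), Fintype.card ι ^ Fintype.card κ :=
        Finset.sum_le_sum fun i hi => (Nat.choose_le_pow _ _).trans
          (Nat.pow_le_pow_right hι (Finset.mem_Iic.1 hi))
    _ = _ := by simp

lemma signVar_congr {m : ℕ} {q q' : ℝ[X]} {t t' : ℝ}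
    (h : ∀ l ≤ m, (0 < (derivative^[l] q).eval t ↔ 0 < (derivative^[l] q').eval t')) :
    signVar m q t = signVar m q' t' := by
  induction m generalizing q q' with
  | zero => rfl
  | succ m ih =>
    have h0 := h 0 (by omega)
    have h1 := h 1 (by omega)
    simp only [Function.iterate_zero, id, Function.iterate_one] at h0 h1
    simp only [signVar, h0, h1]
    rw [ih fun l hl => h (l + 1) (by omega)]

/-- The Lagrange basis polynomials at the nodes `0, …, k`. -/
abbrev lagr (k i : ℕ) : ℝ[X] :=
  Lagrange.basis (Finset.range (k + 1)) (fun i : ℕ => (i : ℝ)) i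

lemma Bi.slice_eq {k : ℕ} {f : ℝ → ℝ → ℝ} (hf : Bi k f) (x : ℝ) :
    slice (f x) = ∑ p ∈ Finset.range (k + 1) ×ˢ Finset.range (k + 1),
      C (f p.1 p.2 * (lagr k p.1).eval x) * lagr k p.2 := by
  rw [← slice_eval (∑ p ∈ Finset.range (k + 1) ×ˢ Finset.range (k + 1),
      C (f p.1 p.2 * (lagr k p.1).eval x) * lagr k p.2)]
  congr 1
  ext y
  rw [hf.eq_sum x y, eval_finsetSum, Finset.sum_product_right]
  refine Finset.sum_congr rfl fun b _ => ?_
  have := hf.flip.eq_sum b x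
  simp only [_root_.flip] at this
  rw [this, Finset.sum_mul]
  exact Finset.sum_congr rfl fun a _ => by simp

lemma Bi.exists_representatives (k L : ℕ) : ∃ Φ : Finset (ℝ → ℝ → ℝ), (∀ f ∈ Φ, Bi k f) ∧
    Φ.card ≤ ((k + 1) * (k + 1) + 1) *
      ((k + 1) * ((L + 1) * (L + 1))) ^ ((k + 1) * (k + 1)) ∧
    ∀ f, Bi k f → ∃ f' ∈ Φ, ∀ p : ℕ × ℕ, p.1 < L → p.2 < L → dv k f p = dv k f' p := by
  classical
  set ι := Fin (k + 1) × (Fin (L + 1) × Fin (L + 1))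
  set κ := Fin (k + 1) × Fin (k + 1)
  let v : ι → κ → ℝ := fun i p =>
    (lagr k p.1).eval (i.2.1 : ℝ) * (derivative^[i.1] (lagr k p.2)).eval (i.2.2 : ℝ)
  let pat : (ℝ → ℝ → ℝ) → Finset ι := fun f => Finset.univ.filter fun i =>
    0 < (derivative^[i.1] (slice (f i.2.1))).eval (i.2.2 : ℝ)
  have hpat : ∀ f, Bi k f → ∀ i, i ∈ pat f ↔ 0 < v i ⬝ᵥ fun p => f p.1 p.2 := by
    intro f hf i
    simp only [pat, Finset.mem_filter, Finset.mem_univ, true_and]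
    rw [hf.slice_eq, iterate_derivative_sum, eval_finsetSum, Finset.sum_product]
    simp only [iterate_derivative_C_mul, eval_mul, eval_C]
    rw [dotProduct, Fintype.sum_prod_type, Finset.sum_range]
    simp only [Finset.sum_range, v]
    refine iff_of_eq (congrArg _ ?_)
    exact Finset.sum_congr rfl fun a _ => Finset.sum_congr rfl fun b _ => by ring
  set 𝒜 : Finset (Finset ι) := Finset.univ.filter fun S => ∃ f, Bi k f ∧ pat f = S with h𝒜
  have hmem : ∀ S ∈ 𝒜, ∃ f, Bi k f ∧ pat f = S := fun S hS => (Finset.mem_filter.1 hS).2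
  choose! rep hrep using hmem
  have hcard : 𝒜.card ≤ _ := card_positivity_le v 𝒜 fun S hS => by
    obtain ⟨hb, e⟩ := hrep S hS
    exact ⟨_, fun i => by rw [← hpat _ hb, e]⟩
  refine ⟨𝒜.image rep, ?_, Finset.card_image_le.trans (by simpa [ι, κ] using hcard), ?_⟩
  · intro f hf
    obtain ⟨S, hS, rfl⟩ := Finset.mem_image.1 hf
    exact (hrep S hS).1
  · intro f hf
    have hS : pat f ∈ 𝒜 := Finset.mem_filter.2 ⟨Finset.mem_univ _, f, hf, rfl⟩
    refine ⟨rep (pat f), Finset.mem_image_of_mem _ hS, fun p h1 h2 => ?_⟩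
    have e := (hrep _ hS).2
    have hvar : ∀ j : ℕ, j < L + 1 →
        fnVar k (f p.1) j = fnVar k (rep (pat f) p.1) j := by
      intro j hj
      refine signVar_congr fun l hl => ?_
      have := Finset.ext_iff.1 e (⟨l, by omega⟩, ⟨p.1, by omega⟩, ⟨j, hj⟩)
      simp only [pat, Finset.mem_filter, Finset.mem_univ, true_and] at this
      exact this.symm
    have e1 := hvar p.2 (by omega)
    have e2 := hvar (p.2 + 1) (by omega)
    push_cast at e2
    rw [dv, dv, e1, e2]

lemma sum_exp_le {δ : Type*} [Fintype δ] [Nonempty δ] {η s : ℝ} (hη1 : η ≤ 1) (hs : 0 ≤ s)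
    (g : δ → ℝ) (hg0 : ∀ c, 0 ≤ g c) (hgc : ∀ c, s * g c ≤ η) :
    ∑ c, Real.exp (s * g c) ≤
      Fintype.card δ * Real.exp ((1 + η) * s / Fintype.card δ * ∑ c, g c) := by
  have hδ : (0 : ℝ) < Fintype.card δ := by exact_mod_cast Fintype.card_pos
  have h1 : ∀ c, Real.exp (s * g c) ≤ 1 + (1 + η) * s * g c := by
    intro c
    have h0 : 0 ≤ s * g c := mul_nonneg hs (hg0 c)
    have := Real.abs_exp_sub_one_sub_id_le (x := s * g c)
      (by rw [abs_of_nonneg h0]; exact (hgc c).trans hη1)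
    have := (abs_le.1 this).2
    nlinarith [hgc c]
  calc ∑ c, Real.exp (s * g c) ≤ ∑ c, (1 + (1 + η) * s * g c) :=
        Finset.sum_le_sum fun c _ => h1 c
    _ = Fintype.card δ * ((1 + η) * s / Fintype.card δ * ∑ c, g c + 1) := by
        rw [Finset.sum_add_distrib, ← Finset.mul_sum]
        simp only [Finset.sum_const, Finset.card_univ, nsmul_eq_mul, mul_one]
        field_simp
        ring
    _ ≤ _ := mul_le_mul_of_nonneg_left (Real.add_one_le_exp _) hδ.le

/-- A Chernoff bound for independent uniform choices, with a union bound over `I`. -/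
lemma exists_choice {α β δ : Type*} [Fintype δ] [Nonempty δ] (A : Finset α) (I : Finset β)
    (g : β → α → δ → ℝ) {c M η : ℝ} (hc : 0 < c) (hη0 : 0 < η) (hη1 : η ≤ 1)
    (hg0 : ∀ i ∈ I, ∀ Q ∈ A, ∀ d, 0 ≤ g i Q d) (hgc : ∀ i ∈ I, ∀ Q ∈ A, ∀ d, g i Q d ≤ c)
    (hM : ∀ i ∈ I, ∑ Q ∈ A, ∑ d, g i Q d ≤ Fintype.card δ * M)
    (hI : I.card * Real.exp (-(η ^ 2 * M / c)) < 1) :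
    ∃ σ : α → δ, ∀ i ∈ I, ∑ Q ∈ A, g i Q (σ Q) ≤ M * (1 + 2 * η) := by
  classical
  by_contra! hbad
  set s := η / c with hs
  have hs0 : 0 < s := div_pos hη0 hc
  have hδ : (0 : ℝ) < Fintype.card δ := by exact_mod_cast Fintype.card_pos
  have hmom : ∀ i ∈ I, ∑ σ : A → δ, Real.exp (s * ∑ Q : A, g i Q (σ Q)) ≤
      Fintype.card δ ^ A.card * Real.exp ((1 + η) * s * M) := by
    intro i hi
    calc ∑ σ : A → δ, Real.exp (s * ∑ Q : A, g i Q (σ Q))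
        = ∏ Q : A, ∑ d, Real.exp (s * g i Q d) := by
          rw [Finset.prod_univ_sum, Fintype.piFinset_univ]
          exact Finset.sum_congr rfl fun σ _ => by rw [Finset.mul_sum, Real.exp_sum]
      _ ≤ ∏ Q : A, (Fintype.card δ * Real.exp ((1 + η) * s / Fintype.card δ * ∑ d, g i Q d)) := by
          refine Finset.prod_le_prod (fun Q _ => Finset.sum_nonneg fun d _ => (Real.exp_pos _).le)
            fun Q _ => sum_exp_le hη1 hs0.le _ (hg0 i hi Q Q.2) fun d => ?_
          calc s * g i Q d ≤ s * c := mul_le_mul_of_nonneg_left (hgc i hi Q Q.2 d) hs0.le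
            _ = η := by rw [hs]; field_simp
      _ = Fintype.card δ ^ A.card *
            Real.exp ((1 + η) * s / Fintype.card δ * ∑ Q ∈ A, ∑ d, g i Q d) := by
          rw [Finset.prod_mul_distrib, ← Real.exp_sum, ← Finset.mul_sum, Finset.prod_const,
            Finset.sum_coe_sort A fun Q => ∑ d, g i Q d]
          simp
      _ ≤ _ := by
          refine mul_le_mul_of_nonneg_left (Real.exp_le_exp.2 ?_) (by positivity)
          calc _ ≤ (1 + η) * s / Fintype.card δ * (Fintype.card δ * M) :=
                mul_le_mul_of_nonneg_left (hM i hi) (by positivity)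
            _ = _ := by field_simp
  have hlow : ∀ σ : A → δ, Real.exp (s * (M * (1 + 2 * η))) ≤
      ∑ i ∈ I, Real.exp (s * ∑ Q : A, g i Q (σ Q)) := by
    intro σ
    obtain ⟨i, hi, hlt⟩ := hbad fun Q => if h : Q ∈ A then σ ⟨Q, h⟩ else Classical.arbitrary δ
    rw [← Finset.sum_coe_sort A] at hlt
    simp only [Finset.coe_mem, dif_pos, Subtype.coe_eta] at hlt
    refine le_trans (Real.exp_le_exp.2 (mul_le_mul_of_nonneg_left hlt.le hs0.le))
      (Finset.single_le_sum (f := fun i => Real.exp (s * ∑ Q : A, g i Q (σ Q)))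
        (fun i _ => (Real.exp_pos _).le) hi)
  have h1 : (Fintype.card δ : ℝ) ^ A.card * Real.exp (s * (M * (1 + 2 * η))) ≤
      I.card * (Fintype.card δ ^ A.card * Real.exp ((1 + η) * s * M)) := by
    calc _ = ∑ σ : A → δ, Real.exp (s * (M * (1 + 2 * η))) := by simp
      _ ≤ ∑ σ : A → δ, ∑ i ∈ I, Real.exp (s * ∑ Q : A, g i Q (σ Q)) :=
          Finset.sum_le_sum fun σ _ => hlow σ
      _ = ∑ i ∈ I, ∑ σ : A → δ, Real.exp (s * ∑ Q : A, g i Q (σ Q)) := Finset.sum_comm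
      _ ≤ ∑ i ∈ I, Fintype.card δ ^ A.card * Real.exp ((1 + η) * s * M) :=
          Finset.sum_le_sum hmom
      _ = _ := by simp
  have h2 : Real.exp ((1 + η) * s * M) =
      Real.exp (s * (M * (1 + 2 * η))) * Real.exp (-(η ^ 2 * M / c)) := by
    rw [← Real.exp_add]
    congr 1
    rw [hs]
    field_simp
    ring
  rw [h2] at h1
  have h3 : (0 : ℝ) < Fintype.card δ ^ A.card * Real.exp (s * (M * (1 + 2 * η))) := by positivity
  nlinarith

lemma child_injective : Function.Injective fun x : (ℕ × ℕ) × (Fin 2 × Fin 2) => child x.1 x.2 := by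
  rintro ⟨⟨i, j⟩, ⟨a, b⟩⟩ ⟨⟨i', j'⟩, ⟨a', b'⟩⟩ h
  simp only [child, Prod.mk.injEq] at h
  simp only [Prod.mk.injEq, Fin.ext_iff]
  omega

/-- The child with digit `c` if `full`, and the child chosen by `σ` otherwise. -/
def stepTo (full : Prop) (σ : ℕ × ℕ → Fin 2 × Fin 2) (Q : ℕ × ℕ) (c : Fin 2 × Fin 2) : ℕ × ℕ :=
  open Classical in child Q (if full then c else σ Q)

/-- The next generation of squares. -/
def nextGen (full : Prop) (σ : ℕ × ℕ → Fin 2 × Fin 2) (A : Finset (ℕ × ℕ)) : Finset (ℕ × ℕ) :=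
  (A ×ˢ Finset.univ).image fun x => stepTo full σ x.1 x.2

lemma nextGen_of_full {full : Prop} (h : full) (σ : ℕ × ℕ → Fin 2 × Fin 2) (A : Finset (ℕ × ℕ)) :
    nextGen full σ A = (A ×ˢ Finset.univ).image fun x => child x.1 x.2 := by
  simp [nextGen, stepTo, h]

lemma nextGen_of_not_full {full : Prop} (h : ¬ full) (σ : ℕ × ℕ → Fin 2 × Fin 2)
    (A : Finset (ℕ × ℕ)) : nextGen full σ A = A.image fun Q => child Q (σ Q) := by
  ext Q
  simp [nextGen, stepTo, h]

lemma sum_nextGen_of_full {full : Prop} (h : full) (σ : ℕ × ℕ → Fin 2 × Fin 2)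
    (A : Finset (ℕ × ℕ)) (u : ℕ × ℕ → ℝ) :
    ∑ Q ∈ nextGen full σ A, u Q = ∑ Q ∈ A, ∑ c, u (child Q c) := by
  rw [nextGen_of_full h, Finset.sum_image fun x _ y _ e => child_injective e, Finset.sum_product]

lemma sum_nextGen_of_not_full {full : Prop} (h : ¬ full) (σ : ℕ × ℕ → Fin 2 × Fin 2)
    (A : Finset (ℕ × ℕ)) (u : ℕ × ℕ → ℝ) :
    ∑ Q ∈ nextGen full σ A, u Q = ∑ Q ∈ A, u (child Q (σ Q)) := by
  rw [nextGen_of_not_full h, Finset.sum_image]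
  intro x _ y _ e
  have := child_injective (a₁ := (x, σ x)) (a₂ := (y, σ y)) e
  exact congrArg Prod.fst this

/-- The normalized counts of squares meeting a bivariate polynomial curve are at most `M`. -/
def CountBound (k : ℕ) (A : Finset (ℕ × ℕ)) (b M : ℝ) : Prop :=
  ∀ f, Bi k f → b * ∑ p ∈ A, (dv k f p : ℝ) ≤ M ∧ b * ∑ p ∈ A, (dh k f p : ℝ) ≤ M

lemma CountBound.mono {k : ℕ} {A : Finset (ℕ × ℕ)} {b M M' : ℝ} (h : CountBound k A b M)
    (hM : M ≤ M') : CountBound k A b M' :=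
  fun f hf => ⟨(h f hf).1.trans hM, (h f hf).2.trans hM⟩

lemma CountBound.sum_child_le {k : ℕ} {A : Finset (ℕ × ℕ)} {b M : ℝ} (h : CountBound k A b M)
    {f : ℝ → ℝ → ℝ} (hf : Bi k f) :
    b * ∑ p ∈ A, ∑ c, (dv k f (child p c) : ℝ) ≤ 2 * M ∧
      b * ∑ p ∈ A, ∑ c, (dh k f (child p c) : ℝ) ≤ 2 * M := by
  have h00 := h _ (hf.affine 2 0 0)
  have h10 := h _ (hf.affine 2 1 0)
  have h01 := h _ (hf.affine 2 0 1)
  have e1 : ∀ p, ∑ c, (dv k f (child p c) : ℝ) = _ := fun p =>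
    (Nat.cast_sum _ _).symm.trans (congrArg Nat.cast (sum_dv_child hf p))
  have e2 : ∀ p, ∑ c, (dh k f (child p c) : ℝ) = _ := fun p =>
    (Nat.cast_sum _ _).symm.trans (congrArg Nat.cast (sum_dh_child hf p))
  simp only [e1, e2, Finset.sum_add_distrib, mul_add, Nat.cast_add]
  constructor <;> linarith [h00.1, h00.2, h10.1, h01.2]

lemma CountBound.next_full {k : ℕ} {A : Finset (ℕ × ℕ)} {b M : ℝ} (h : CountBound k A b M)
    {full : Prop} (hfull : full) (σ : ℕ × ℕ → Fin 2 × Fin 2) :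
    CountBound k (nextGen full σ A) (b / 2) M := by
  intro f hf
  have := h.sum_child_le hf
  rw [sum_nextGen_of_full hfull, sum_nextGen_of_full hfull]
  constructor <;> linarith [this.1, this.2]

lemma CountBound.next_any {k : ℕ} {A : Finset (ℕ × ℕ)} {b M : ℝ} (hb : 0 ≤ b)
    (h : CountBound k A b M) {full : Prop} (hfull : ¬ full) (σ : ℕ × ℕ → Fin 2 × Fin 2) :
    CountBound k (nextGen full σ A) (2 * b) (4 * M) := by
  intro f hf
  have := h.sum_child_le hf
  rw [sum_nextGen_of_not_full hfull, sum_nextGen_of_not_full hfull]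
  have key : ∀ u : ℕ × ℕ → ℝ, (∀ Q, 0 ≤ u Q) →
      b * ∑ Q ∈ A, u (child Q (σ Q)) ≤ b * ∑ Q ∈ A, ∑ c, u (child Q c) := fun u hu =>
    mul_le_mul_of_nonneg_left (Finset.sum_le_sum fun Q _ =>
      Finset.single_le_sum (f := fun c => u (child Q c)) (fun c _ => hu _) (Finset.mem_univ _)) hb
  have k1 := key (fun Q => dv k f Q) fun Q => Nat.cast_nonneg _
  have k2 := key (fun Q => dh k f Q) fun Q => Nat.cast_nonneg _
  constructor <;> linarith [this.1, this.2]

/-- Bound for the number of sign patterns at generation `n + 1`. -/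
def patternCount (k n : ℕ) : ℕ :=
  2 * (((k + 1) * (k + 1) + 1) *
    ((k + 1) * ((2 ^ (n + 1) + 1) * (2 ^ (n + 1) + 1))) ^ ((k + 1) * (k + 1)))

lemma CountBound.exists_next {k n : ℕ} {A : Finset (ℕ × ℕ)} {b M η : ℝ} (hb : 0 < b) (hM : 1 ≤ M)
    (h : CountBound k A b M) (hA : ∀ p ∈ A, p.1 < 2 ^ n ∧ p.2 < 2 ^ n)
    (hη0 : 0 < η) (hη1 : η ≤ 1)
    (hη : patternCount k n * Real.exp (-(η ^ 2 / (2 * (k + 1) * b))) < 1)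
    {full : Prop} (hfull : ¬ full) :
    ∃ σ, CountBound k (nextGen full σ A) (2 * b) (M * (1 + 2 * η)) := by
  classical
  obtain ⟨Φ, hΦ, hcard, hrep⟩ := Bi.exists_representatives k (2 ^ (n + 1))
  let g : (ℝ → ℝ → ℝ) × Bool → ℕ × ℕ → Fin 2 × Fin 2 → ℝ := fun f Q c =>
    2 * b * (dv k f.1 (if f.2 then (child Q c).swap else child Q c) : ℝ)
  have hex := exists_choice A (Φ ×ˢ (Finset.univ : Finset Bool)) g
    (c := 2 * (k + 1) * b) (M := M) (η := η) (by positivity) hη0 hη1 ?_ ?_ ?_ ?_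
  · obtain ⟨σ, hσ⟩ := hex
    refine ⟨σ, fun f hf => ?_⟩
    rw [sum_nextGen_of_not_full hfull, sum_nextGen_of_not_full hfull]
    have hlt : ∀ Q ∈ A, ∀ c, (child Q c).1 < 2 ^ (n + 1) ∧ (child Q c).2 < 2 ^ (n + 1) := by
      intro Q hQ c
      have := hA Q hQ
      simp only [child, pow_succ]
      omega
    constructor
    · obtain ⟨f', hf', he⟩ := hrep f hf
      have := hσ (f', false) (by simp [hf'])
      simp only [g, ← Finset.mul_sum] at this
      convert this using 4 with Q hQ
      simpa using he _ (hlt Q hQ _).1 (hlt Q hQ _).2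
    · obtain ⟨f', hf', he⟩ := hrep _ hf.flip
      have := hσ (f', true) (by simp [hf'])
      simp only [g, ← Finset.mul_sum] at this
      convert this using 4 with Q hQ
      simpa [dh] using he (child Q (σ Q)).swap (hlt Q hQ _).2 (hlt Q hQ _).1
  · intro f _ Q _ c
    positivity
  · intro f _ Q _ c
    have : (dv k f.1 (if f.2 then (child Q c).swap else child Q c) : ℝ) ≤ k := by
      exact_mod_cast dv_le _ _ _
    simp only [g]
    nlinarith
  · rintro ⟨f, o⟩ hf
    have hf' : Bi k f := hΦ f (Finset.mem_product.1 hf).1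
    cases o with
    | false =>
      have := (h.sum_child_le hf').1
      simp only [g, ← Finset.mul_sum, Bool.false_eq_true, if_false]
      simp
      linarith
    | true =>
      have := (h.sum_child_le hf'.flip).2
      simp only [g, ← Finset.mul_sum, if_true]
      simp only [dh] at this
      simp
      have e : flip (flip f) = f := rfl
      rw [e] at this
      linarith
  · refine lt_of_le_of_lt ?_ hη
    refine mul_le_mul ?_ (Real.exp_le_exp.2 ?_) (Real.exp_pos _).le (Nat.cast_nonneg _)
    · rw [Finset.card_product, Finset.card_univ, Fintype.card_bool, patternCount, mul_comm]
      exact_mod_cast Nat.mul_le_mul_left 2 hcard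
    · refine neg_le_neg (div_le_div_of_nonneg_right ?_ (by positivity))
      nlinarith [sq_nonneg η]

lemma tendsto_patternCount (k : ℕ) : Filter.Tendsto
    (fun n : ℕ => (patternCount k n : ℝ) * Real.exp (-(((n : ℝ) + 1) ^ 2 / (2 * (k + 1)))))
    Filter.atTop (nhds 0) := by
  set D := (k + 1) * (k + 1) with hD
  set B : ℝ := 2 ^ (2 * D) with hB
  set K : ℝ := 2 * ((D + 1) * (k + 1) ^ D) * B with hK
  have hB0 : 0 < B := by positivity
  have hle : ∀ n : ℕ, (patternCount k n : ℝ) ≤ K * B ^ (n + 1) := by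
    intro n
    have h2 : (2 : ℝ) ^ (n + 1) + 1 ≤ 2 ^ (n + 2) := by
      have : (1 : ℝ) ≤ 2 ^ (n + 1) := one_le_pow₀ (by norm_num)
      rw [pow_succ (2 : ℝ) (n + 1)]
      linarith
    calc (patternCount k n : ℝ)
        = 2 * ((D + 1) * (k + 1) ^ D) * (((2 : ℝ) ^ (n + 1) + 1) ^ (2 * D)) := by
          rw [patternCount, ← hD]
          generalize D = d
          push_cast
          rw [pow_mul _ 2, sq, mul_pow]
          ring
      _ ≤ 2 * ((D + 1) * (k + 1) ^ D) * (((2 : ℝ) ^ (n + 2)) ^ (2 * D)) := by gcongr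
      _ = K * B ^ (n + 1) := by
          rw [hK, hB, mul_assoc _ (2 ^ (2 * D)), ← pow_succ', ← pow_mul, ← pow_mul, mul_comm (n + 2)]
  have hlim : Filter.Tendsto (fun n : ℕ => K * Real.exp (((n : ℝ) + 1) *
      (Real.log B - ((n : ℝ) + 1) / (2 * (k + 1))))) Filter.atTop (nhds 0) := by
    have hn : Filter.Tendsto (fun n : ℕ => (n : ℝ) + 1) Filter.atTop Filter.atTop :=
      Filter.tendsto_atTop_add_const_right _ _ tendsto_natCast_atTop_atTop
    have h1 : Filter.Tendsto (fun n : ℕ => Real.log B - ((n : ℝ) + 1) / (2 * (k + 1)))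
        Filter.atTop Filter.atBot := by
      simp only [sub_eq_add_neg]
      refine Filter.tendsto_atBot_add_const_left _ _ (Filter.tendsto_neg_atTop_atBot.comp ?_)
      exact hn.atTop_div_const (by positivity)
    simpa using ((Real.tendsto_exp_atBot.comp (hn.atTop_mul_atBot₀ h1)).const_mul K)
  refine squeeze_zero (fun n => by positivity) (fun n => ?_) hlim
  calc _ ≤ K * B ^ (n + 1) * Real.exp (-(((n : ℝ) + 1) ^ 2 / (2 * (k + 1)))) :=
        mul_le_mul_of_nonneg_right (hle n) (Real.exp_pos _).le
    _ = _ := by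
        have : B ^ (n + 1) = Real.exp (((n : ℝ) + 1) * Real.log B) := by
          rw [mul_comm, Real.exp_mul, Real.exp_log hB0]
          exact_mod_cast (Real.rpow_natCast B (n + 1)).symm
        rw [this, mul_assoc, ← Real.exp_add]
        congr 2
        ring

lemma nextGen_lt {n : ℕ} {A : Finset (ℕ × ℕ)} (hA : ∀ p ∈ A, p.1 < 2 ^ n ∧ p.2 < 2 ^ n)
    (full : Prop) (σ : ℕ × ℕ → Fin 2 × Fin 2) :
    ∀ p ∈ nextGen full σ A, p.1 < 2 ^ (n + 1) ∧ p.2 < 2 ^ (n + 1) := by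
  intro p hp
  obtain ⟨⟨Q, c⟩, hQ, rfl⟩ := Finset.mem_image.1 hp
  have := hA Q (Finset.mem_product.1 hQ).1
  simp only [stepTo, child, pow_succ]
  omega

/-- The random construction: there are choices for which all the counts stay bounded. -/
lemma exists_generations (k : ℕ) (full : ℕ → Prop) (b : ℕ → ℝ) (hb0 : b 0 = 1)
    (hbpos : ∀ n, 0 < b n) (hfull : ∀ n, full n → b (n + 1) = b n / 2)
    (hnot : ∀ n, ¬ full n → b (n + 1) = 2 * b n)
    (hsum : Summable fun n : ℕ => ((n : ℝ) + 1) * Real.sqrt (b n)) :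
    ∃ (ch : ℕ → ℕ × ℕ → Fin 2 × Fin 2) (A : ℕ → Finset (ℕ × ℕ)) (M : ℝ), A 0 = {(0, 0)} ∧
      (∀ n, A (n + 1) = nextGen (full n) (ch n) (A n)) ∧ ∀ n, CountBound k (A n) (b n) M := by
  set η : ℕ → ℝ := fun n => ((n : ℝ) + 1) * Real.sqrt (b n) with hη
  have hηpos : ∀ n, 0 < η n := fun n =>
    mul_pos (by positivity) (Real.sqrt_pos.2 (hbpos n))
  have hev : ∀ᶠ n in Filter.atTop, η n ≤ 1 ∧
      (patternCount k n : ℝ) * Real.exp (-(((n : ℝ) + 1) ^ 2 / (2 * (k + 1)))) < 1 :=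
    (hsum.tendsto_atTop_zero.eventually_le_const one_pos).and
      ((tendsto_patternCount k).eventually_lt_const one_pos)
  obtain ⟨n₀, hn₀⟩ := Filter.eventually_atTop.1 hev
  set θ : ℕ → ℝ := fun n => 2 * η n + if n < n₀ then 3 else 0 with hθ
  have hθpos : ∀ n, 0 ≤ θ n := fun n => by
    have := (hηpos n).le
    simp only [hθ]
    split_ifs <;> linarith
  have hθsum : Summable θ := by
    refine (hsum.mul_left 2).add (summable_of_ne_finset_zero (s := Finset.range n₀) fun n hn => ?_)
    rw [if_neg (by simpa using hn)]
  set M : ℕ → ℝ := fun n => (k + 1) * ∏ i ∈ Finset.range n, (1 + θ i) with hM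
  have hMsucc : ∀ n, M (n + 1) = M n * (1 + θ n) := fun n => by
    simp only [hM, Finset.prod_range_succ]
    ring
  have hM1 : ∀ n, 1 ≤ M n := by
    intro n
    have : 1 ≤ ∏ i ∈ Finset.range n, (1 + θ i) := by
      refine Finset.prod_induction _ (1 ≤ ·) (fun _ _ => one_le_mul_of_one_le_of_one_le) le_rfl
        fun i _ => ?_
      linarith [hθpos i]
    have hk : (0 : ℝ) ≤ k := Nat.cast_nonneg k
    simp only [hM]
    nlinarith
  have hMle : ∀ n, M n ≤ (k + 1) * Real.exp (∑' i, θ i) := by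
    intro n
    refine mul_le_mul_of_nonneg_left ?_ (by positivity)
    calc ∏ i ∈ Finset.range n, (1 + θ i) ≤ ∏ i ∈ Finset.range n, Real.exp (θ i) :=
          Finset.prod_le_prod (fun i _ => by linarith [hθpos i]) fun i _ => by
            linarith [Real.add_one_le_exp (θ i)]
      _ = Real.exp (∑ i ∈ Finset.range n, θ i) := (Real.exp_sum _ _).symm
      _ ≤ _ := Real.exp_le_exp.2 (hθsum.sum_le_tsum _ fun i _ => hθpos i)
  have hstep : ∀ n A, ∃ σ, (∀ p ∈ A, p.1 < 2 ^ n ∧ p.2 < 2 ^ n) →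
      CountBound k A (b n) (M n) → CountBound k (nextGen (full n) σ A) (b (n + 1)) (M (n + 1)) := by
    intro n A
    by_cases hA : ∀ p ∈ A, p.1 < 2 ^ n ∧ p.2 < 2 ^ n
    swap
    · exact ⟨fun _ => (0, 0), fun h => absurd h hA⟩
    by_cases hC : CountBound k A (b n) (M n)
    swap
    · exact ⟨fun _ => (0, 0), fun _ h => absurd h hC⟩
    have hM0 : 0 ≤ M n := zero_le_one.trans (hM1 n)
    suffices ∃ σ, CountBound k (nextGen (full n) σ A) (b (n + 1)) (M (n + 1)) by
      obtain ⟨σ, hσ⟩ := this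
      exact ⟨σ, fun _ _ => hσ⟩
    rw [hMsucc]
    by_cases hf : full n
    · refine ⟨fun _ => (0, 0), ?_⟩
      rw [hfull n hf]
      refine (hC.next_full hf _).mono ?_
      nlinarith [hθpos n]
    rw [hnot n hf]
    by_cases hn : n < n₀
    · refine ⟨fun _ => (0, 0), (hC.next_any (hbpos n).le hf _).mono ?_⟩
      have : 3 ≤ θ n := by simp only [hθ, if_pos hn]; linarith [hηpos n]
      nlinarith
    · obtain ⟨h1, h2⟩ := hn₀ n (not_lt.1 hn)
      have hb := hbpos n
      obtain ⟨σ, hσ⟩ := hC.exists_next hb (hM1 n) hA (hηpos n) h1 (by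
        convert h2 using 4
        simp only [hη]
        rw [mul_pow, Real.sq_sqrt hb.le]
        field_simp) hf
      refine ⟨σ, hσ.mono ?_⟩
      simp [hθ, if_neg hn]
  choose pick hpick using hstep
  let A : ℕ → Finset (ℕ × ℕ) := fun n =>
    Nat.rec {(0, 0)} (fun n A => nextGen (full n) (pick n A) A) n
  have hlt : ∀ n, ∀ p ∈ A n, p.1 < 2 ^ n ∧ p.2 < 2 ^ n := by
    intro n
    induction n with
    | zero => intro p hp; simp [Finset.mem_singleton.1 hp]
    | succ n ih => exact nextGen_lt ih _ _
  have hbd : ∀ n, CountBound k (A n) (b n) (M n) := by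
    intro n
    induction n with
    | zero =>
      intro f _
      have h1 : (dv k f (0, 0) : ℝ) ≤ k := by exact_mod_cast dv_le _ _ _
      have h2 : (dh k f (0, 0) : ℝ) ≤ k := by exact_mod_cast dh_le _ _ _
      simp only [show A 0 = {(0, 0)} from rfl, hM, hb0, Finset.sum_singleton,
        Finset.range_zero, Finset.prod_empty]
      constructor <;> linarith
    | succ n ih => exact hpick n _ (hlt n) ih
  exact ⟨fun n => pick n (A n), A, (k + 1) * Real.exp (∑' i, θ i), rfl, fun n => rfl,
    fun n => (hbd n).mono (hMle n)⟩

lemma summable_of_integrableOn {h : ℝ → ℝ} (hpos : ∀ t : ℝ, 0 < t → 0 < h t)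
    (hmono : ∀ s t : ℝ, 0 < s → s ≤ t → h s ≤ h t)
    (hint : IntegrableOn (fun t => t⁻¹ * |Real.log t| * Real.sqrt (t⁻¹ * h t)) (Set.Ioo 0 1)
      volume) :
    Summable fun n : ℕ => ((n : ℝ) + 1) * Real.sqrt (2 ^ n * h ((2 ^ n)⁻¹)) := by
  set f : ℝ → ℝ := fun t => t⁻¹ * |Real.log t| * Real.sqrt (t⁻¹ * h t) with hf
  set r : ℕ → ℝ := fun n => (2 ^ n)⁻¹ with hr
  have hr0 : ∀ n, 0 < r n := fun n => by positivity
  have hr1 : ∀ n, r n ≤ 1 := fun n => inv_le_one_of_one_le₀ (one_le_pow₀ one_le_two)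
  have hanti : Antitone r := fun a b hab =>
    inv_anti₀ (by positivity) (pow_le_pow_right₀ one_le_two hab)
  set I : ℕ → Set ℝ := fun n => Ioo (r (n + 1)) (r n) with hI
  have hsub : ⋃ n, I n ⊆ Ioo 0 1 :=
    iUnion_subset fun n x hx => ⟨(hr0 _).trans hx.1, hx.2.trans_le (hr1 n)⟩
  have hdisj : Pairwise (Function.onFun Disjoint I) := by
    have key : ∀ a b, a < b → Disjoint (I a) (I b) := fun a b hab =>
      Set.disjoint_left.2 fun x hx hx' => absurd (hx.1.trans hx'.2) (hanti hab).not_gt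
    intro a b hab
    rcases hab.lt_or_gt with h | h
    · exact key a b h
    · exact (key b a h).symm
  have hsum : Summable fun n => ∫ t in I n, f t :=
    (hasSum_integral_iUnion (fun n => measurableSet_Ioo) hdisj (hint.mono_set hsub)).summable
  have hlog : 0 < Real.log 2 := Real.log_pos one_lt_two
  have hlow : ∀ n : ℕ, n * Real.log 2 / 2 * Real.sqrt (2 ^ n * h (r (n + 1))) ≤
      ∫ t in I n, f t := by
    intro n
    have h1 := setIntegral_ge_of_const_le_real (μ := volume) (s := I n) (f := f)
      (c := 2 ^ n * (n * Real.log 2) * Real.sqrt (2 ^ n * h (r (n + 1)))) measurableSet_Ioo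
      (by simp [hI]) ?_ (hint.mono_set ((subset_iUnion I n).trans hsub))
    · refine le_trans (le_of_eq ?_) h1
      rw [measureReal_def, Real.volume_Ioo, ENNReal.toReal_ofReal (sub_nonneg.2 (hanti n.le_succ))]
      simp only [hr, pow_succ]
      field_simp
      ring
    · intro t ht
      have ht0 : 0 < t := (hr0 _).trans ht.1
      have h2 : (2 : ℝ) ^ n ≤ t⁻¹ := by
        rw [le_inv_comm₀ (by positivity) ht0]
        exact ht.2.le
      have h3 : n * Real.log 2 ≤ |Real.log t| := by
        have := Real.log_le_log (by positivity) h2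
        rw [Real.log_pow, Real.log_inv] at this
        exact this.trans (neg_le_abs _)
      have h4 := hmono _ _ (hr0 (n + 1)) ht.1.le
      have h5 := hpos _ (hr0 (n + 1))
      simp only [hf]
      gcongr
  rw [← summable_nat_add_iff 2]
  have hsum' := ((summable_nat_add_iff 1).2 hsum).mul_left (6 * Real.sqrt 2 / Real.log 2)
  refine Summable.of_nonneg_of_le (fun n => by positivity) (fun n => ?_) hsum'
  refine le_trans ?_ (mul_le_mul_of_nonneg_left (hlow (n + 1)) (by positivity))
  have e : Real.sqrt (2 ^ (n + 2) * h ((2 ^ (n + 2))⁻¹)) =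
      Real.sqrt 2 * Real.sqrt (2 ^ (n + 1) * h (r (n + 1 + 1))) := by
    rw [← Real.sqrt_mul zero_le_two]
    congr 1
    simp only [hr, pow_succ]
    ring
  rw [e]
  set S := Real.sqrt (2 ^ (n + 1) * h (r (n + 1 + 1)))
  have hS : 0 ≤ S := Real.sqrt_nonneg _
  calc ((n + 2 : ℕ) + 1 : ℝ) * (Real.sqrt 2 * S) ≤ (3 * (n + 1)) * (Real.sqrt 2 * S) := by
        refine mul_le_mul_of_nonneg_right ?_ (by positivity)
        push_cast
        linarith [(Nat.cast_nonneg n : (0 : ℝ) ≤ n)]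
    _ = _ := by
        push_cast
        field_simp
        ring

/-- Numbers of squares, chosen so that `growth H n * H n` stays comparable to `H 0`. -/
def growth (H : ℕ → ℝ) : ℕ → ℕ
  | 0 => 1
  | n + 1 => open Classical in if growth H n * H n ≤ H 0 then 4 * growth H n else growth H n

lemma growth_bounds {H : ℕ → ℝ} (h0 : ∀ n, 0 < H n) (h1 : ∀ n, H (n + 1) ≤ H n)
    (h4 : ∀ n, H n ≤ 4 * H (n + 1)) (n : ℕ) :
    H 0 ≤ 4 * (growth H n * H n) ∧ growth H n * H n ≤ 4 * H 0 := by
  induction n with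
  | zero => simp only [growth, Nat.cast_one]; constructor <;> linarith [h0 0]
  | succ n ih =>
    have hg : (0 : ℝ) ≤ growth H n := Nat.cast_nonneg _
    have k1 := mul_le_mul_of_nonneg_left (h1 n) hg
    have k2 := mul_le_mul_of_nonneg_left (h4 n) hg
    simp only [growth]
    split_ifs with hc
    · push_cast
      constructor <;> linarith
    · constructor <;> linarith

lemma growth_pos (H : ℕ → ℝ) (n : ℕ) : 0 < growth H n := by
  induction n with
  | zero => exact one_pos
  | succ n ih =>
    simp only [growth]
    split_ifs <;> omega

lemma summable_sqrt_growth {H : ℕ → ℝ} (h0 : ∀ n, 0 < H n) (h1 : ∀ n, H (n + 1) ≤ H n)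
    (h4 : ∀ n, H n ≤ 4 * H (n + 1))
    (hs : Summable fun n : ℕ => ((n : ℝ) + 1) * Real.sqrt (2 ^ n * H n)) :
    Summable fun n : ℕ => ((n : ℝ) + 1) * Real.sqrt (2 ^ n / growth H n) := by
  refine Summable.of_nonneg_of_le (fun n => by positivity) (fun n => ?_)
    (hs.mul_left (Real.sqrt (4 / H 0)))
  have hg : (0 : ℝ) < growth H n := by exact_mod_cast growth_pos H n
  have hH := h0 0
  rw [mul_left_comm, ← Real.sqrt_mul (by positivity)]
  gcongr
  have := (growth_bounds h0 h1 h4 n).1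
  rw [div_mul_eq_mul_div, div_le_div_iff₀ hg hH]
  nlinarith [pow_pos (two_pos (α := ℝ)) n]

section

instance : IsProbabilityMeasure (ProbabilityTheory.uniformOn (univ : Set (Fin 2 × Fin 2))) :=
  ProbabilityTheory.isProbabilityMeasure_uniformOn finite_univ univ_nonempty

/-- The fair coin-tossing measure on digit sequences. -/
def digitMeasure : Measure (ℕ → Fin 2 × Fin 2) :=
  Measure.infinitePi fun _ => ProbabilityTheory.uniformOn univ

instance : IsProbabilityMeasure digitMeasure := by
  unfold digitMeasure
  infer_instance

lemma digitMeasure_pi (n : ℕ) (t : ℕ → Set (Fin 2 × Fin 2)) :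
    digitMeasure (Set.pi (Finset.range n) t) =
      ∏ i ∈ Finset.range n, ProbabilityTheory.uniformOn univ (t i) := by
  exact Measure.infinitePi_pi _ fun _ _ => MeasurableSet.of_discrete

variable (full : ℕ → Prop) (ch : ℕ → ℕ × ℕ → Fin 2 × Fin 2)

/-- The sequence of nested squares determined by a sequence of digits. -/
def path (ω : ℕ → Fin 2 × Fin 2) : ℕ → ℕ × ℕ
  | 0 => (0, 0)
  | n + 1 => stepTo (full n) (ch n) (path ω n) (ω n)

variable {full ch}

lemma child_half (p : ℕ × ℕ) (c : Fin 2 × Fin 2) :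
    ((child p c).1 / 2, (child p c).2 / 2) = p := by
  rcases p with ⟨i, j⟩
  simp only [child, Prod.mk.injEq]
  omega

lemma path_half (ω : ℕ → Fin 2 × Fin 2) (n : ℕ) :
    ((path full ch ω (n + 1)).1 / 2, (path full ch ω (n + 1)).2 / 2) = path full ch ω n :=
  child_half _ _

lemma path_eq_of_path_eq {ω ω' : ℕ → Fin 2 × Fin 2} {n m : ℕ} (hnm : n ≤ m)
    (h : path full ch ω m = path full ch ω' m) : path full ch ω n = path full ch ω' n := by
  induction m, hnm using Nat.le_induction with
  | base => exact h
  | succ m _ ih => exact ih (by rw [← path_half ω m, ← path_half ω' m, h])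

lemma continuous_path (n : ℕ) : Continuous fun ω => path full ch ω n := by
  induction n with
  | zero => exact continuous_const
  | succ n ih =>
    have : Continuous fun x : (ℕ × ℕ) × (Fin 2 × Fin 2) => stepTo (full n) (ch n) x.1 x.2 :=
      continuous_of_discreteTopology
    exact this.comp (ih.prodMk (continuous_apply n))

lemma path_mem {A : ℕ → Finset (ℕ × ℕ)} (hA0 : A 0 = {(0, 0)})
    (hA : ∀ n, A (n + 1) = nextGen (full n) (ch n) (A n)) (ω : ℕ → Fin 2 × Fin 2) (n : ℕ) :
    path full ch ω n ∈ A n := by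
  induction n with
  | zero => simp [hA0, path]
  | succ n ih =>
    rw [hA, nextGen]
    exact Finset.mem_image.2 ⟨(_, ω n), by simpa using ih, rfl⟩

lemma exists_cylinder {A : ℕ → Finset (ℕ × ℕ)} (hA0 : A 0 = {(0, 0)})
    (hA : ∀ n, A (n + 1) = nextGen (full n) (ch n) (A n)) (n : ℕ) : ∀ Q ∈ A n,
    ∃ t : ℕ → Set (Fin 2 × Fin 2), {ω | path full ch ω n = Q} = Set.pi (Finset.range n) t ∧
      ∏ i ∈ Finset.range n, ProbabilityTheory.uniformOn univ (t i) = ((A n).card : ℝ≥0∞)⁻¹ := by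
  induction n with
  | zero =>
    intro Q hQ
    rw [hA0, Finset.mem_singleton] at hQ
    exact ⟨fun _ => univ, by simp [path, hQ], by simp [hA0]⟩
  | succ n ih =>
    intro Q hQ
    have key : ∀ Q' c (s : Set (Fin 2 × Fin 2)) (r : ℝ≥0∞), Q' ∈ A n → child Q' c = Q →
        (∀ d, child Q' (open Classical in if full n then d else ch n Q') = Q ↔ d ∈ s) →
        ProbabilityTheory.uniformOn univ s = r →
        ((A n).card : ℝ≥0∞)⁻¹ * r = ((A (n + 1)).card : ℝ≥0∞)⁻¹ →
        ∃ t : ℕ → Set (Fin 2 × Fin 2),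
          {ω | path full ch ω (n + 1) = Q} = Set.pi (Finset.range (n + 1)) t ∧
          ∏ i ∈ Finset.range (n + 1), ProbabilityTheory.uniformOn univ (t i) =
            ((A (n + 1)).card : ℝ≥0∞)⁻¹ := by
      intro Q' c s r hQ' hc hs hr hP
      obtain ⟨t, ht, hp⟩ := ih Q' hQ'
      have hu : ∀ i ∈ Finset.range n, Function.update t n s i = t i := fun i hi =>
        Function.update_of_ne (Finset.mem_range.1 hi).ne _ _
      refine ⟨Function.update t n s, ?_, ?_⟩
      · ext ω
        have h1 : path full ch ω n = Q' ↔ ∀ i < n, ω i ∈ t i := by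
          have := Set.ext_iff.1 ht ω
          simpa [Set.mem_pi] using this
        have h2 : path full ch ω (n + 1) = Q ↔ path full ch ω n = Q' ∧ ω n ∈ s := by
          constructor
          · intro hω
            have e : path full ch ω n = Q' := by
              rw [← path_half ω n, hω, ← hc, child_half]
            refine ⟨e, (hs _).1 ?_⟩
            rw [← hω, ← e]
            rfl
          · rintro ⟨e, hω⟩
            rw [← (hs _).2 hω, ← e]
            rfl
        simp only [mem_ofPred_eq, h2, h1, Set.mem_pi, Finset.coe_range, mem_Iio,
          Nat.lt_succ_iff_lt_or_eq, or_imp, forall_and, forall_eq, Function.update_self]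
        refine and_congr_left fun _ => forall₂_congr fun i hi => ?_
        rw [hu i (Finset.mem_range.2 hi)]
      · rw [Finset.prod_range_succ, Function.update_self, hr, ← hP, ← hp]
        congr 1
        exact Finset.prod_congr rfl fun i hi => by rw [hu i hi]
    by_cases hf : full n
    · have hQ2 := hQ
      rw [hA, nextGen_of_full hf] at hQ2
      obtain ⟨⟨Q', c⟩, h1, h2⟩ := Finset.mem_image.1 hQ2
      have hcard := sum_nextGen_of_full hf (ch n) (A n) fun _ => 1
      simp only [Finset.sum_const, nsmul_eq_mul, mul_one, ← hA, Finset.card_univ,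
        Fintype.card_prod, Fintype.card_fin] at hcard
      have hcard' : (A (n + 1)).card = (A n).card * 4 := by exact_mod_cast hcard
      refine key Q' c {c} 4⁻¹ (by simpa using h1) h2 ?_ ?_ ?_
      · intro d
        simp only [hf, if_true, mem_singleton_iff, ← h2]
        constructor
        · intro e
          exact congrArg Prod.snd (child_injective (a₁ := (Q', d)) (a₂ := (Q', c)) e)
        · rintro rfl; rfl
      · rw [ProbabilityTheory.uniformOn_univ]
        simp
      · rw [hcard', Nat.cast_mul, ENNReal.mul_inv (by simp) (by simp)]
        rfl
    · have hQ2 := hQ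
      rw [hA, nextGen_of_not_full hf] at hQ2
      obtain ⟨Q', h1, h2⟩ := Finset.mem_image.1 hQ2
      have hcard := sum_nextGen_of_not_full hf (ch n) (A n) fun _ => 1
      simp only [Finset.sum_const, nsmul_eq_mul, mul_one, ← hA] at hcard
      have hcard' : (A (n + 1)).card = (A n).card := by exact_mod_cast hcard
      refine key Q' (ch n Q') univ 1 h1 h2 ?_ ?_ ?_
      · intro d
        simp [hf, h2]
      · exact measure_univ
      · rw [hcard', mul_one]

lemma digitMeasure_path_eq {A : ℕ → Finset (ℕ × ℕ)} (hA0 : A 0 = {(0, 0)})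
    (hA : ∀ n, A (n + 1) = nextGen (full n) (ch n) (A n)) {n : ℕ} {Q : ℕ × ℕ} (hQ : Q ∈ A n) :
    digitMeasure {ω | path full ch ω n = Q} = ((A n).card : ℝ≥0∞)⁻¹ := by
  obtain ⟨t, ht, hp⟩ := exists_cylinder hA0 hA n Q hQ
  rw [ht, digitMeasure_pi, hp]

/-- A set of squares has measure its proportion among the squares of that generation. -/
lemma digitMeasure_path_mem {A : ℕ → Finset (ℕ × ℕ)} (hA0 : A 0 = {(0, 0)})
    (hA : ∀ n, A (n + 1) = nextGen (full n) (ch n) (A n)) {n : ℕ} {D : Finset (ℕ × ℕ)}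
    (hD : D ⊆ A n) :
    digitMeasure {ω | path full ch ω n ∈ D} = D.card / ((A n).card : ℝ≥0∞) := by
  have e : {ω | path full ch ω n ∈ D} = ⋃ Q ∈ D, {ω | path full ch ω n = Q} := by
    ext ω; simp
  rw [e, measure_biUnion_finset]
  · rw [Finset.sum_congr rfl fun Q hQ => digitMeasure_path_eq hA0 hA (hD hQ), Finset.sum_const,
      nsmul_eq_mul, div_eq_mul_inv]
  · intro Q _ Q' _ hne
    refine Set.disjoint_left.2 fun ω h1 h2 => hne ?_
    exact (h1 : _ = Q).symm.trans h2
  · intro Q _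
    exact ((isClosed_singleton (x := Q)).preimage (continuous_path n)).measurableSet

end

section

lemma abs_sub_le_dist (x y : Pt 2) (i : Fin 2) : |x i - y i| ≤ dist x y := by
  rw [dist_eq_norm]
  exact PiLp.norm_apply_le (x - y) i

lemma dist_le_two_mul {x y : Pt 2} {a : ℝ} (h0 : |x 0 - y 0| ≤ a) (h1 : |x 1 - y 1| ≤ a) :
    dist x y ≤ 2 * a := by
  have ha : 0 ≤ a := (abs_nonneg _).trans h0
  rw [EuclideanSpace.dist_eq, Fin.sum_univ_two, Real.dist_eq, Real.dist_eq]
  refine Real.sqrt_le_iff.2 ⟨by positivity, ?_⟩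
  nlinarith [pow_le_pow_left₀ (abs_nonneg _) h0 2, pow_le_pow_left₀ (abs_nonneg _) h1 2]

/-- The lower left corner of the `n`-th generation dyadic square with index `Q`. -/
def corner (n : ℕ) (Q : ℕ × ℕ) : Pt 2 := !₂[(Q.1 : ℝ) / 2 ^ n, (Q.2 : ℝ) / 2 ^ n]

@[simp] lemma corner_zero (n : ℕ) (Q : ℕ × ℕ) : corner n Q 0 = Q.1 / 2 ^ n := rfl

@[simp] lemma corner_one (n : ℕ) (Q : ℕ × ℕ) : corner n Q 1 = Q.2 / 2 ^ n := rfl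

lemma dist_corner_child (n : ℕ) (Q : ℕ × ℕ) (c : Fin 2 × Fin 2) :
    dist (corner n Q) (corner (n + 1) (child Q c)) ≤ 2 / 2 / 2 ^ n := by
  have key : ∀ (i : ℕ) (a : Fin 2),
      |(i : ℝ) / 2 ^ n - ((2 * i + a : ℕ) : ℝ) / 2 ^ (n + 1)| ≤ 1 / 2 / 2 ^ n := by
    intro i a
    have e : (i : ℝ) / 2 ^ n - ((2 * i + a : ℕ) : ℝ) / 2 ^ (n + 1) = -((a : ℕ) / 2 / 2 ^ n : ℝ) := by
      push_cast
      rw [pow_succ]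
      field_simp
      ring
    have ha : ((a : ℕ) : ℝ) ≤ 1 := by exact_mod_cast Nat.lt_succ_iff.1 a.2
    rw [e, abs_neg, abs_of_nonneg (by positivity)]
    gcongr
  refine (dist_le_two_mul (key Q.1 c.1) (key Q.2 c.2)).trans_eq ?_
  ring

variable (full : ℕ → Prop) (ch : ℕ → ℕ × ℕ → Fin 2 × Fin 2)

/-- The point coded by a sequence of digits. -/
def codedPoint (ω : ℕ → Fin 2 × Fin 2) : Pt 2 :=
  Filter.limUnder Filter.atTop fun n => corner n (path full ch ω n)

variable {full ch}

lemma dist_corner_codedPoint (ω : ℕ → Fin 2 × Fin 2) (n : ℕ) :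
    dist (corner n (path full ch ω n)) (codedPoint full ch ω) ≤ 2 / 2 ^ n := by
  have h : ∀ n, dist (corner n (path full ch ω n)) (corner (n + 1) (path full ch ω (n + 1))) ≤
      2 / 2 / 2 ^ n := fun n => dist_corner_child _ _ _
  exact dist_le_of_le_geometric_two_of_tendsto h
    (cauchySeq_of_le_geometric_two h).tendsto_limUnder n

lemma continuous_corner (n : ℕ) : Continuous (corner n) := continuous_of_discreteTopology

lemma tendsto_const_div_two_pow (c : ℝ) :
    Filter.Tendsto (fun n : ℕ => c / 2 ^ n) Filter.atTop (nhds 0) :=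
  tendsto_const_nhds.div_atTop (tendsto_pow_atTop_atTop_of_one_lt one_lt_two)

lemma continuous_codedPoint : Continuous (codedPoint full ch) := by
  have hu : TendstoUniformly (fun n ω => corner n (path full ch ω n)) (codedPoint full ch)
      Filter.atTop := by
    refine Metric.tendstoUniformly_iff.2 fun ε hε => ?_
    filter_upwards [(tendsto_const_div_two_pow 2).eventually_lt_const hε] with n hn ω
    rw [dist_comm]
    exact (dist_corner_codedPoint ω n).trans_lt hn
  exact hu.continuous (Filter.Frequently.of_forall fun n =>
    (continuous_corner n).comp (continuous_path n))

variable (full ch) in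
/-- The set of coded points. -/
def codedSet : Set (Pt 2) := range (codedPoint full ch)

lemma isCompact_codedSet : IsCompact (codedSet full ch) := isCompact_range continuous_codedPoint

variable (full ch) in
/-- The natural measure on the set of coded points. -/
def codedMeasure : Measure (Pt 2) := digitMeasure.map (codedPoint full ch)

instance : IsProbabilityMeasure (codedMeasure full ch) :=
  Measure.isProbabilityMeasure_map continuous_codedPoint.aemeasurable

lemma codedMeasure_apply {s : Set (Pt 2)} (hs : MeasurableSet s) :
    codedMeasure full ch s = digitMeasure (codedPoint full ch ⁻¹' s) :=
  Measure.map_apply continuous_codedPoint.measurable hs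

lemma codedMeasure_codedSet : codedMeasure full ch (codedSet full ch) = 1 := by
  rw [codedMeasure_apply isCompact_codedSet.measurableSet, codedSet, preimage_range, measure_univ]

variable {A : ℕ → Finset (ℕ × ℕ)}

lemma codedSet_subset (hA0 : A 0 = {(0, 0)})
    (hA : ∀ n, A (n + 1) = nextGen (full n) (ch n) (A n)) (n : ℕ) :
    codedSet full ch ⊆ ⋃ x ∈ (A n).image (corner n), closedBall x (2 / 2 ^ n) := by
  rintro _ ⟨ω, rfl⟩
  refine mem_biUnion (Finset.mem_image_of_mem _ (path_mem hA0 hA ω n)) ?_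
  rw [mem_closedBall, dist_comm]
  exact dist_corner_codedPoint ω n

/-- A set of points near the corners of the squares in `D` has small measure. -/
lemma digitMeasure_le_of_path_mem (hA0 : A 0 = {(0, 0)})
    (hA : ∀ n, A (n + 1) = nextGen (full n) (ch n) (A n)) {n : ℕ} {S : Set (ℕ → Fin 2 × Fin 2)}
    {D : Finset (ℕ × ℕ)} (hS : ∀ ω ∈ S, path full ch ω n ∈ D) :
    digitMeasure S ≤ D.card / ((A n).card : ℝ≥0∞) := by
  classical
  calc digitMeasure S ≤ digitMeasure {ω | path full ch ω n ∈ D ∩ A n} :=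
        measure_mono fun ω hω => Finset.mem_inter.2 ⟨hS ω hω, path_mem hA0 hA ω n⟩
    _ = (D ∩ A n).card / ((A n).card : ℝ≥0∞) :=
        digitMeasure_path_mem hA0 hA Finset.inter_subset_right
    _ ≤ _ := by
        gcongr
        exact Finset.inter_subset_left

lemma mem_Icc_of_abs_le {i n : ℕ} {x : ℝ} (h : |(i : ℝ) / 2 ^ n - x| ≤ 3 / 2 ^ n) :
    i ∈ Finset.Icc ⌈2 ^ n * x - 3⌉₊ (⌈2 ^ n * x - 3⌉₊ + 6) := by
  have h2 : (0 : ℝ) < 2 ^ n := by positivity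
  have h' : |(i : ℝ) - 2 ^ n * x| ≤ 3 := by
    have e : (i : ℝ) - 2 ^ n * x = 2 ^ n * ((i : ℝ) / 2 ^ n - x) := by field_simp
    rw [e, abs_mul, abs_of_pos h2]
    calc (2 : ℝ) ^ n * |(i : ℝ) / 2 ^ n - x| ≤ 2 ^ n * (3 / 2 ^ n) := by gcongr
      _ = 3 := by field_simp
  rw [abs_le] at h'
  have hc := Nat.le_ceil (2 ^ n * x - 3)
  refine Finset.mem_Icc.2 ⟨Nat.ceil_le.2 (by linarith), ?_⟩
  have : (i : ℝ) ≤ (⌈2 ^ n * x - 3⌉₊ + 6 : ℕ) := by push_cast; linarith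
  exact_mod_cast this

lemma codedMeasure_closedBall_le (hA0 : A 0 = {(0, 0)})
    (hA : ∀ n, A (n + 1) = nextGen (full n) (ch n) (A n)) (n : ℕ) (x : Pt 2) :
    codedMeasure full ch (closedBall x (1 / 2 ^ n)) ≤ 49 / ((A n).card : ℝ≥0∞) := by
  rw [codedMeasure_apply measurableSet_closedBall]
  have key := digitMeasure_le_of_path_mem hA0 hA (n := n)
    (S := codedPoint full ch ⁻¹' closedBall x (1 / 2 ^ n))
    (D := Finset.Icc ⌈2 ^ n * x 0 - 3⌉₊ (⌈2 ^ n * x 0 - 3⌉₊ + 6) ×ˢ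
      Finset.Icc ⌈2 ^ n * x 1 - 3⌉₊ (⌈2 ^ n * x 1 - 3⌉₊ + 6)) ?_
  · refine key.trans_eq ?_
    rw [Finset.card_product, Nat.card_Icc, Nat.card_Icc]
    congr 1
    have : ∀ a : ℕ, a + 6 + 1 - a = 7 := fun a => by omega
    rw [this, this]
    norm_num
  · intro ω hω
    have hd : dist (corner n (path full ch ω n)) x ≤ 3 / 2 ^ n := by
      have := dist_triangle (corner n (path full ch ω n)) (codedPoint full ch ω) x
      have e : (3 : ℝ) / 2 ^ n = 2 / 2 ^ n + 1 / 2 ^ n := by ring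
      rw [e]
      exact this.trans (add_le_add (dist_corner_codedPoint ω n) hω)
    exact Finset.mem_product.2 ⟨mem_Icc_of_abs_le ((abs_sub_le_dist _ x 0).trans hd),
      mem_Icc_of_abs_le ((abs_sub_le_dist _ x 1).trans hd)⟩

end

section

variable {full : ℕ → Prop} {ch : ℕ → ℕ × ℕ → Fin 2 × Fin 2} {A : ℕ → Finset (ℕ × ℕ)}
  {h : ℝ → ℝ} {c : ℝ}

/-- The gauge measure of a union of coded cylinders is at most their measure, up to a constant. -/
lemma gMeasure_image_le (hA0 : A 0 = {(0, 0)})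
    (hA : ∀ n, A (n + 1) = nextGen (full n) (ch n) (A n))
    (hdoub : ∀ t : ℝ, 0 < t → h (2 * t) ≤ 4 * h t)
    (hup : ∀ m, (A m).card * h ((2 ^ m)⁻¹) ≤ c) (n : ℕ) (G : Set (ℕ × ℕ)) :
    gMeasure h (codedPoint full ch '' {ω | path full ch ω n ∈ G}) ≤
      ENNReal.ofReal (16 * c) * digitMeasure {ω | path full ch ω n ∈ G} := by
  classical
  set S := {ω | path full ch ω n ∈ G} with hS
  let D : ℕ → Finset (ℕ × ℕ) := fun m => (A m).filter fun Q => ∃ ω ∈ S, path full ch ω m = Q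
  have hD : ∀ m, n ≤ m → {ω | path full ch ω m ∈ D m} = S := by
    intro m hm
    ext ω
    simp only [D, Finset.mem_filter, mem_ofPred_eq]
    constructor
    · rintro ⟨-, ω', hω', e⟩
      have := path_eq_of_path_eq hm e
      rw [hS, mem_ofPred_eq, ← this]
      exact hω'
    · intro hω
      exact ⟨path_mem hA0 hA ω m, ω, hω, rfl⟩
  have hdiam : ∀ (m : ℕ) (x : Pt 2), diam (closedBall x (2 / 2 ^ m)) = 4 / 2 ^ m := by
    intro m x
    rw [Metric.diam_closedBall_eq x (by positivity)]
    ring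
  have hgauge : ∀ m : ℕ, h (4 / 2 ^ m) ≤ 16 * h ((2 ^ m)⁻¹) := by
    intro m
    have h1 := hdoub (2 ^ m)⁻¹ (by positivity)
    have h2 := hdoub (2 * (2 ^ m)⁻¹) (by positivity)
    have e : (4 : ℝ) / 2 ^ m = 2 * (2 * (2 ^ m)⁻¹) := by ring
    rw [e]
    linarith
  have key := Measure.mkMetric_le_liminf_sum (ι := fun m => D m) (l := Filter.atTop)
    (codedPoint full ch '' S) (fun m : ℕ => ENNReal.ofReal (4 / 2 ^ m)) ?_
    (fun m Q => closedBall (corner m Q) (2 / 2 ^ m)) ?_ ?_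
    (fun r : ℝ≥0∞ => ENNReal.ofReal (h r.toReal))
  · refine key.trans (Filter.liminf_le_of_le (by isBoundedDefault) fun b hb => ?_)
    obtain ⟨m, hm, hnm⟩ := (hb.and (Filter.eventually_ge_atTop n)).exists
    refine hm.trans ?_
    have e : ∀ Q : D m, ENNReal.ofReal
        (h (ediam (closedBall (corner m (Q : ℕ × ℕ)) (2 / 2 ^ m))).toReal) =
        ENNReal.ofReal (h (4 / 2 ^ m)) := fun Q => by
      rw [← hdiam m (corner m Q)]; rfl
    rw [Finset.sum_congr rfl fun Q _ => e Q, Finset.sum_const, Finset.card_univ,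
      Fintype.card_coe, nsmul_eq_mul, ← hD m hnm,
      digitMeasure_path_mem hA0 hA (Finset.filter_subset _ _)]
    have hpos : 0 < (A m).card :=
      Finset.card_pos.2 ⟨_, path_mem hA0 hA (fun _ => (0, 0)) m⟩
    have hposR : (0 : ℝ) < (A m).card := by exact_mod_cast hpos
    rw [← ENNReal.ofReal_natCast (D m).card, ← ENNReal.ofReal_natCast (A m).card,
      ← ENNReal.ofReal_div_of_pos hposR, ← ENNReal.ofReal_mul (Nat.cast_nonneg _),
      ← ENNReal.ofReal_mul' (div_nonneg (Nat.cast_nonneg _) (Nat.cast_nonneg _))]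
    refine ENNReal.ofReal_le_ofReal ?_
    rw [← mul_div_assoc, le_div_iff₀ hposR, mul_right_comm, mul_comm (16 * c), mul_assoc]
    refine mul_le_mul_of_nonneg_left ?_ (Nat.cast_nonneg _)
    have := mul_le_mul_of_nonneg_left (hgauge m) hposR.le
    linarith [hup m]
  · have := ENNReal.tendsto_ofReal (tendsto_const_div_two_pow 4)
    simpa using this
  · refine Filter.Eventually.of_forall fun m Q => ?_
    rw [← hdiam m (corner m Q), Metric.diam, ENNReal.ofReal_toReal]
    exact isBounded_closedBall.ediam_ne_top
  · refine Filter.eventually_atTop.2 ⟨n, fun m hm => ?_⟩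
    rintro _ ⟨ω, hω, rfl⟩
    rw [← hD m hm] at hω
    refine mem_iUnion.2 ⟨⟨_, hω⟩, ?_⟩
    rw [mem_closedBall, dist_comm]
    exact dist_corner_codedPoint ω m

lemma codedMeasure_singleton (hA0 : A 0 = {(0, 0)})
    (hA : ∀ n, A (n + 1) = nextGen (full n) (ch n) (A n)) {c : ℝ} (hc : 0 < c)
    (hlim : Filter.Tendsto h (nhdsWithin 0 (Set.Ioi 0)) (nhds 0))
    (hlo : ∀ m, c ≤ (A m).card * h ((2 ^ m)⁻¹)) (x : Pt 2) : codedMeasure full ch {x} = 0 := by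
  have hH : Filter.Tendsto (fun m : ℕ => h ((2 ^ m)⁻¹)) Filter.atTop (nhds 0) := by
    refine hlim.comp (tendsto_nhdsWithin_iff.2 ⟨?_, Filter.Eventually.of_forall fun m => ?_⟩)
    · simpa [one_div] using tendsto_const_div_two_pow 1
    · exact mem_Ioi.2 (by positivity)
  have hT : Filter.Tendsto (fun m : ℕ => ENNReal.ofReal (49 / c * h ((2 ^ m)⁻¹))) Filter.atTop
      (nhds 0) := by
    simpa using ENNReal.tendsto_ofReal (hH.const_mul (49 / c))
  refine le_antisymm (ge_of_tendsto' hT fun m => ?_) (zero_le)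
  calc codedMeasure full ch {x} ≤ codedMeasure full ch (closedBall x (1 / 2 ^ m)) :=
        measure_mono (singleton_subset_iff.2 (mem_closedBall_self (by positivity)))
    _ ≤ _ := codedMeasure_closedBall_le hA0 hA m x
    _ ≤ _ := by
        have hpos : 0 < (A m).card :=
          Finset.card_pos.2 ⟨_, path_mem hA0 hA (fun _ => (0, 0)) m⟩
        have hposR : (0 : ℝ) < (A m).card := by exact_mod_cast hpos
        rw [← ENNReal.ofReal_natCast (A m).card, ← ENNReal.ofReal_ofNat 49,
          ← ENNReal.ofReal_div_of_pos hposR]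
        refine ENNReal.ofReal_le_ofReal ?_
        rw [div_le_iff₀ hposR, div_mul_eq_mul_div, div_mul_eq_mul_div, le_div_iff₀ hc]
        linarith [hlo m]

/-- The mass distribution principle for the coded measure. -/
lemma codedMeasure_le_gMeasure (hA0 : A 0 = {(0, 0)})
    (hA : ∀ n, A (n + 1) = nextGen (full n) (ch n) (A n)) {c : ℝ} (hc : 0 < c)
    (hmono : ∀ s t : ℝ, 0 < s → s ≤ t → h s ≤ h t)
    (hdoub : ∀ t : ℝ, 0 < t → h (2 * t) ≤ 4 * h t)
    (hlim : Filter.Tendsto h (nhdsWithin 0 (Set.Ioi 0)) (nhds 0))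
    (hlo : ∀ m, c ≤ (A m).card * h ((2 ^ m)⁻¹)) :
    ENNReal.ofReal (c / 196) • codedMeasure full ch ≤ gMeasure h := by
  refine Measure.le_mkMetric _ _ 1 one_pos fun s hs => ?_
  rw [Measure.smul_apply, smul_eq_mul]
  rcases s.eq_empty_or_nonempty with rfl | ⟨x, hx⟩
  · simp
  rcases eq_or_ne (ediam s) 0 with h0 | h0
  · have : s ⊆ {x} := fun y hy => (Metric.ediam_eq_zero_iff.1 h0) hy hx
    rw [measure_mono_null this (codedMeasure_singleton hA0 hA hc hlim hlo x), mul_zero]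
    exact zero_le
  have htop : ediam s ≠ ⊤ := ne_top_of_le_ne_top ENNReal.one_ne_top hs
  obtain ⟨n, hn1, hn2⟩ := exists_nat_pow_near_of_lt_one (ENNReal.toReal_pos h0 htop)
    (ENNReal.toReal_le_of_le_ofReal zero_le_one (by simpa using hs))
    (y := (1 / 2 : ℝ)) (by norm_num) (by norm_num)
  set d := (ediam s).toReal with hd
  have hsub : s ⊆ closedBall x (1 / 2 ^ n) := by
    intro y hy
    rw [mem_closedBall, dist_edist]
    refine (ENNReal.toReal_mono htop (Metric.edist_le_ediam_of_mem hy hx)).trans ?_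
    simpa [one_div] using hn2
  have hH : h ((2 ^ n)⁻¹) ≤ 4 * h d := by
    have h1 := hdoub (2 ^ (n + 1))⁻¹ (by positivity)
    have e : (2 : ℝ) * (2 ^ (n + 1))⁻¹ = (2 ^ n)⁻¹ := by
      rw [pow_succ]; field_simp
    rw [e] at h1
    have h2 := hmono (2 ^ (n + 1))⁻¹ d (by positivity) (by simpa [one_div] using hn1.le)
    linarith
  have hpos : 0 < (A n).card :=
    Finset.card_pos.2 ⟨_, path_mem hA0 hA (fun _ => (0, 0)) n⟩
  have hposR : (0 : ℝ) < (A n).card := by exact_mod_cast hpos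
  calc ENNReal.ofReal (c / 196) * codedMeasure full ch s
      ≤ ENNReal.ofReal (c / 196) * (49 / ((A n).card : ℝ≥0∞)) := by
        gcongr
        exact (measure_mono hsub).trans (codedMeasure_closedBall_le hA0 hA n x)
    _ ≤ ENNReal.ofReal (h d) := by
        rw [← ENNReal.ofReal_natCast (A n).card, ← ENNReal.ofReal_ofNat 49,
          ← ENNReal.ofReal_div_of_pos hposR, ← ENNReal.ofReal_mul (by positivity)]
        refine ENNReal.ofReal_le_ofReal ?_
        rw [← mul_div_assoc, div_le_iff₀ hposR]
        have := mul_le_mul_of_nonneg_left hH hposR.le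
        linarith [hlo n]

/-- Sets that are null for the coded measure are null for the gauge measure. -/
lemma gMeasure_eq_zero (hA0 : A 0 = {(0, 0)})
    (hA : ∀ n, A (n + 1) = nextGen (full n) (ch n) (A n))
    (hdoub : ∀ t : ℝ, 0 < t → h (2 * t) ≤ 4 * h t)
    (hup : ∀ m, (A m).card * h ((2 ^ m)⁻¹) ≤ c) {B : Set (Pt 2)} (hB : B ⊆ codedSet full ch)
    (h0 : codedMeasure full ch B = 0) : gMeasure h B = 0 := by
  have main : ∀ ε : ℝ≥0∞, 0 < ε → gMeasure h B ≤ ENNReal.ofReal (16 * c) * ε := by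
    intro ε hε
    obtain ⟨V, hBV, hV, hVε⟩ := B.exists_isOpen_lt_of_lt (μ := codedMeasure full ch) ε (h0 ▸ hε)
    let G : ℕ → Set (ℕ × ℕ) := fun n => {Q | closedBall (corner n Q) (2 / 2 ^ n) ⊆ V}
    let S : ℕ → Set (ℕ → Fin 2 × Fin 2) := fun n => {ω | path full ch ω n ∈ G n}
    have hSmono : Monotone S := by
      refine monotone_nat_of_le_succ fun n ω hω => ?_
      refine (closedBall_subset_closedBall' ?_).trans (show closedBall _ _ ⊆ V from hω)
      have := dist_corner_child n (path full ch ω n) 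
        (open Classical in if full n then ω n else ch n (path full ch ω n))
      rw [dist_comm]
      calc 2 / 2 ^ (n + 1) + dist (corner n (path full ch ω n))
            (corner (n + 1) (path full ch ω (n + 1))) ≤ 2 / 2 ^ (n + 1) + 2 / 2 / 2 ^ n :=
            add_le_add_right this _
        _ = 2 / 2 ^ n := by rw [pow_succ]; field_simp; norm_num
    have hSV : ∀ n, S n ⊆ codedPoint full ch ⁻¹' V := by
      intro n ω hω
      refine (show closedBall _ _ ⊆ V from hω) ?_
      rw [mem_closedBall, dist_comm]
      exact dist_corner_codedPoint ω n
    have hBS : B ⊆ ⋃ n, codedPoint full ch '' S n := by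
      intro x hx
      obtain ⟨ω, rfl⟩ := hB hx
      obtain ⟨r, hr, hrV⟩ := Metric.isOpen_iff.1 hV _ (hBV hx)
      obtain ⟨n, hn⟩ := ((tendsto_const_div_two_pow 4).eventually_lt_const hr).exists
      refine mem_iUnion.2 ⟨n, ω, ?_, rfl⟩
      refine Subset.trans (fun y hy => ?_) hrV
      rw [mem_closedBall] at hy
      have := dist_triangle y (corner n (path full ch ω n)) (codedPoint full ch ω)
      have e : (4 : ℝ) / 2 ^ n = 2 / 2 ^ n + 2 / 2 ^ n := by ring
      rw [mem_ball]
      linarith [dist_corner_codedPoint (full := full) (ch := ch) ω n]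
    calc gMeasure h B ≤ gMeasure h (⋃ n, codedPoint full ch '' S n) := measure_mono hBS
      _ = ⨆ n, gMeasure h (codedPoint full ch '' S n) :=
          Monotone.measure_iUnion fun m n hmn => image_mono (hSmono hmn)
      _ ≤ ENNReal.ofReal (16 * c) * ε := by
          refine iSup_le fun n => (gMeasure_image_le hA0 hA hdoub hup n (G n)).trans ?_
          gcongr
          refine (measure_mono (hSV n)).trans ?_
          rw [← codedMeasure_apply hV.measurableSet]
          exact hVε.le
  refine le_antisymm ?_ zero_le
  have hT : Filter.Tendsto (fun ε : ℝ≥0∞ => ENNReal.ofReal (16 * c) * ε)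
      (nhdsWithin 0 (Ioi 0)) (nhds 0) := by
    have := ENNReal.Tendsto.const_mul (a := ENNReal.ofReal (16 * c))
      (Filter.tendsto_id (x := nhds (0 : ℝ≥0∞))) (Or.inr ENNReal.ofReal_ne_top)
    rw [mul_zero] at this
    exact this.mono_left nhdsWithin_le_nhds
  refine ge_of_tendsto hT ?_
  filter_upwards [self_mem_nhdsWithin] with ε hε using main ε hε

end

section

lemma isPolyFn_aeval {k : ℕ} {p : MvPolynomial (Fin 2) ℝ} (hp : p.totalDegree ≤ k)
    {s : Fin 2 → ℝ[X]} (hs : ∀ i, (s i).natDegree ≤ 1) {v : ℝ → Fin 2 → ℝ}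
    (hv : ∀ t i, (s i).eval t = v t i) : IsPolyFn k fun t => MvPolynomial.eval (v t) p := by
  refine ⟨MvPolynomial.aeval s p, ?_, ?_⟩
  · have := MvPolynomial.aeval_natDegree_le p hp s hs
    simpa using this
  · funext t
    have h1 : (Polynomial.evalRingHom t).comp (MvPolynomial.aeval s).toRingHom =
        MvPolynomial.eval (v t) := by
      refine MvPolynomial.ringHom_ext (fun a => ?_) fun i => ?_
      · simp
      · simp [hv]
    exact (congrArg (fun g : MvPolynomial (Fin 2) ℝ →+* ℝ => g p) h1).symm

lemma bi_eval {k : ℕ} {p : MvPolynomial (Fin 2) ℝ} (hp : p.totalDegree ≤ k) :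
    Bi k fun x y => MvPolynomial.eval ![x, y] p := by
  constructor
  · intro x
    refine isPolyFn_aeval hp (s := ![C x, X]) (v := fun y => ![x, y]) ?_ ?_
    · intro i; fin_cases i <;> simp
    · intro t i; fin_cases i <;> simp
  · intro y
    refine isPolyFn_aeval hp (s := ![X, C y]) (v := fun x => ![x, y]) ?_ ?_
    · intro i; fin_cases i <;> simp
    · intro t i; fin_cases i <;> simp

lemma exists_eval_ne_zero {p : MvPolynomial (Fin 2) ℝ} (hp : p ≠ 0) :
    ∃ x y : ℝ, MvPolynomial.eval ![x, y] p ≠ 0 := by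
  by_contra! hc
  refine hp (MvPolynomial.funext fun v => ?_)
  have e : v = ![v 0, v 1] := by
    funext i; fin_cases i <;> rfl
  rw [e, hc, map_zero]

lemma CountBound.nonneg {k : ℕ} {A : Finset (ℕ × ℕ)} {b M : ℝ} (hb : 0 < b)
    (h : CountBound k A b M) : 0 ≤ M := by
  refine le_trans ?_ (h (fun _ _ => 0) ⟨fun _ => ⟨0, by simp, by simp⟩,
    fun _ => ⟨0, by simp, by simp⟩⟩).1
  positivity

/-- Bound for the number of squares near the zero set of a bivariate polynomial. -/
lemma CountBound.card_le {k : ℕ} {A D : Finset (ℕ × ℕ)} {b M : ℝ} (hb : 0 < b)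
    (h : CountBound k A b M) {f : ℝ → ℝ → ℝ} (hf : Bi k f) {R : ℕ} (hDA : D ⊆ A)
    (hD : ∀ p ∈ D, 1 ≤
      ∑ r ∈ Finset.range (2 * R), dv k (fun x y => f (x + 0) (y + (0 + (r - R)))) p +
      ∑ l ∈ Finset.range (k + 1), ∑ r ∈ Finset.range (2 * R),
        dh k (fun x y => f (x + (r - R)) (y + l)) p) :
    b * D.card ≤ (2 * R + (k + 1) * (2 * R)) * M := by
  have h1 : (D.card : ℝ) ≤ ∑ p ∈ A,
      (∑ r ∈ Finset.range (2 * R), (dv k (fun x y => f (x + 0) (y + (0 + (r - R)))) p : ℝ) +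
      ∑ l ∈ Finset.range (k + 1), ∑ r ∈ Finset.range (2 * R),
        (dh k (fun x y => f (x + (r - R)) (y + l)) p : ℝ)) := by
    rw [Finset.card_eq_sum_ones, Nat.cast_sum]
    refine (Finset.sum_le_sum fun p hp => ?_).trans
      (Finset.sum_le_sum_of_subset_of_nonneg hDA fun _ _ _ => by positivity)
    exact_mod_cast hD p hp
  refine (mul_le_mul_of_nonneg_left h1 hb.le).trans ?_
  rw [Finset.sum_add_distrib, Finset.sum_comm, mul_add, add_mul]
  refine add_le_add ?_ ?_
  · rw [Finset.mul_sum]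
    refine (Finset.sum_le_sum fun (r : ℕ) _ => (h _ (hf.shift 0 (0 + ((r : ℝ) - R)))).1).trans_eq ?_
    simp
  · rw [Finset.sum_comm, Finset.mul_sum]
    refine (Finset.sum_le_sum (g := fun _ => 2 * R * M) fun l _ => ?_).trans_eq ?_
    · rw [Finset.sum_comm, Finset.mul_sum]
      refine (Finset.sum_le_sum fun (r : ℕ) _ => (h _ (hf.shift ((r : ℝ) - R) l)).2).trans_eq ?_
      simp
    · simp
      ring

variable {full : ℕ → Prop} {ch : ℕ → ℕ × ℕ → Fin 2 × Fin 2} {A : ℕ → Finset (ℕ × ℕ)}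

/-- The coded measure of an algebraic tube is at most a constant times its width. -/
lemma exists_codedMeasure_tube_le (hA0 : A 0 = {(0, 0)})
    (hA : ∀ n, A (n + 1) = nextGen (full n) (ch n) (A n)) {k : ℕ} {b : ℕ → ℝ} {M : ℝ}
    (hbpos : ∀ n, 0 < b n) (hb : ∀ n, b n * (A n).card = 2 ^ n)
    (hM : ∀ n, CountBound k (A n) (b n) M) :
    ∃ K : ℝ, 0 ≤ K ∧ ∀ (w : ℝ) (T : Set (Pt 2)), 0 < w → IsPkTube k w T →
      codedMeasure full ch T ≤ ENNReal.ofReal (K * w) := by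
  classical
  obtain ⟨R, hR⟩ := exists_one_le_sum k
  have hM0 : 0 ≤ M := (hM 0).nonneg (hbpos 0)
  set N : ℝ := 2 * R + (k + 1) * (2 * R) with hN
  have hN0 : 0 ≤ N := by positivity
  refine ⟨4 * (N * M) + 2, by positivity, ?_⟩
  rintro w T hw ⟨γ, ⟨p, hp, hdeg, rfl⟩, rfl⟩
  rcases le_or_gt (1 / 2) w with hw1 | hw1
  · refine prob_le_one.trans ?_
    rw [← ENNReal.ofReal_one]
    refine ENNReal.ofReal_le_ofReal ?_
    nlinarith [mul_nonneg hN0 hM0]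
  obtain ⟨n, hn1, hn2⟩ := exists_nat_pow_near_of_lt_one (x := 2 * w) (y := (1 / 2 : ℝ))
    (by positivity) (by linarith) (by norm_num) (by norm_num)
  have h2 : (0 : ℝ) < 2 ^ n := by positivity
  rw [one_div_pow] at hn1 hn2
  have hwn : w < 1 / 2 ^ n := by linarith
  have hnw : 1 / 2 ^ n < 4 * w := by
    have e : (1 : ℝ) / 2 ^ (n + 1) = 1 / 2 ^ n / 2 := by rw [pow_succ]; field_simp
    linarith
  have hf : Bi k fun x y => MvPolynomial.eval ![(2 ^ n : ℝ)⁻¹ * x + 0, (2 ^ n : ℝ)⁻¹ * y + 0] p :=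
    (bi_eval hdeg).affine (2 ^ n)⁻¹ 0 0
  set f : ℝ → ℝ → ℝ := fun x y =>
    MvPolynomial.eval ![(2 ^ n : ℝ)⁻¹ * x + 0, (2 ^ n : ℝ)⁻¹ * y + 0] p with hfdef
  have hfs : ∀ x y : ℝ, f (2 ^ n * x) (2 ^ n * y) = MvPolynomial.eval ![x, y] p := by
    intro x y
    have e : ∀ x : ℝ, (2 ^ n : ℝ)⁻¹ * (2 ^ n * x) + 0 = x := fun x => by field_simp; ring
    simp only [hfdef, e]
  have hfne : ∃ x y, f x y ≠ 0 := by
    obtain ⟨x, y, hxy⟩ := exists_eval_ne_zero hp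
    exact ⟨2 ^ n * x, 2 ^ n * y, by rwa [hfs]⟩
  let D := (A n).filter fun p => 1 ≤
      ∑ r ∈ Finset.range (2 * R), dv k (fun x y => f (x + 0) (y + (0 + (r - R)))) p +
      ∑ l ∈ Finset.range (k + 1), ∑ r ∈ Finset.range (2 * R),
        dh k (fun x y => f (x + (r - R)) (y + l)) p
  have hcard : b n * D.card ≤ N * M := (hM n).card_le (hbpos n) hf (Finset.filter_subset _ _)
    fun p hp => (Finset.mem_filter.1 hp).2
  rw [codedMeasure_apply isClosed_cthickening.measurableSet]
  refine (digitMeasure_le_of_path_mem hA0 hA (n := n) (D := D) fun ω hω => ?_).trans ?_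
  · refine Finset.mem_filter.2 ⟨path_mem hA0 hA ω n, hR f hf hfne _ ?_⟩
    obtain ⟨z, hz, hdz⟩ := mem_thickening_iff.1
      (cthickening_subset_thickening' (by positivity) hwn _ hω)
    have hd : dist z (corner n (path full ch ω n)) ≤ 3 / 2 ^ n := by
      have t := dist_triangle z (codedPoint full ch ω) (corner n (path full ch ω n))
      have t2 := dist_corner_codedPoint (full := full) (ch := ch) ω n
      rw [dist_comm] at hdz t2
      have e : (3 : ℝ) / 2 ^ n = 2 / 2 ^ n + 1 / 2 ^ n := by ring
      linarith
    have key : ∀ (i : Fin 2) (j : ℕ), corner n (path full ch ω n) i = j / 2 ^ n →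
        |2 ^ n * z i - j| ≤ 3 := by
      intro i j hj
      have t := (abs_sub_le_dist z (corner n (path full ch ω n)) i).trans hd
      rw [hj] at t
      have e : 2 ^ n * z i - j = 2 ^ n * (z i - j / 2 ^ n) := by field_simp
      rw [e, abs_mul, abs_of_pos h2]
      calc (2 : ℝ) ^ n * |z i - j / 2 ^ n| ≤ 2 ^ n * (3 / 2 ^ n) := by gcongr
        _ = 3 := by field_simp
    refine ⟨2 ^ n * z 0, 2 ^ n * z 1, key 0 _ rfl, key 1 _ rfl, ?_⟩
    rw [hfs]
    have e : (![z 0, z 1] : Fin 2 → ℝ) = fun i => z i := by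
      funext i; fin_cases i <;> rfl
    rw [e]
    exact hz
  · have hpos : 0 < (A n).card :=
      Finset.card_pos.2 ⟨_, path_mem hA0 hA (fun _ => (0, 0)) n⟩
    have hposR : (0 : ℝ) < (A n).card := by exact_mod_cast hpos
    rw [← ENNReal.ofReal_natCast (A n).card, ← ENNReal.ofReal_natCast D.card,
      ← ENNReal.ofReal_div_of_pos hposR]
    refine ENNReal.ofReal_le_ofReal ?_
    have e : (D.card : ℝ) / (A n).card = b n * D.card * (1 / 2 ^ n) := by
      rw [← hb n]
      have := (hbpos n).ne'
      field_simp
    rw [e]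
    calc b n * D.card * (1 / 2 ^ n) ≤ N * M * (4 * w) := by gcongr
      _ ≤ _ := by linarith

/-- Algebraically tube null sets are null for the coded measure. -/
lemma codedMeasure_eq_zero_of_pkTubeNull {k : ℕ} {K : ℝ} (hK0 : 0 ≤ K)
    (hK : ∀ (w : ℝ) (T : Set (Pt 2)), 0 < w → IsPkTube k w T →
      codedMeasure full ch T ≤ ENNReal.ofReal (K * w)) {B : Set (Pt 2)} (hB : PkTubeNull k B) :
    codedMeasure full ch B = 0 := by
  have main : ∀ δ : ℝ, 0 < δ → codedMeasure full ch B ≤ ENNReal.ofReal K * ENNReal.ofReal δ := by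
    intro δ hδ
    obtain ⟨T, w, hT, hBT, hw⟩ := hB δ hδ
    calc codedMeasure full ch B ≤ ∑' n, codedMeasure full ch (T n) :=
          (measure_mono hBT).trans (measure_iUnion_le T)
      _ ≤ ∑' n, ENNReal.ofReal K * ENNReal.ofReal (w n) := by
          refine ENNReal.tsum_le_tsum fun n => ?_
          rw [← ENNReal.ofReal_mul hK0]
          exact hK _ _ (hT n).1 (hT n).2
      _ ≤ _ := by
          rw [ENNReal.tsum_mul_left]
          gcongr
  have hT : Filter.Tendsto (fun δ : ℝ => ENNReal.ofReal K * ENNReal.ofReal δ)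
      (nhdsWithin 0 (Ioi 0)) (nhds 0) := by
    have := ENNReal.Tendsto.const_mul (a := ENNReal.ofReal K)
      (ENNReal.tendsto_ofReal (Filter.tendsto_id (x := nhds (0 : ℝ)))) 
      (Or.inr ENNReal.ofReal_ne_top)
    simp only [ENNReal.ofReal_zero, mul_zero] at this
    exact this.mono_left nhdsWithin_le_nhds
  refine le_antisymm (ge_of_tendsto hT ?_) zero_le
  filter_upwards [self_mem_nhdsWithin] with δ hδ using main δ hδ

end

lemma card_eq_growth {H : ℕ → ℝ} {ch : ℕ → ℕ × ℕ → Fin 2 × Fin 2} {A : ℕ → Finset (ℕ × ℕ)}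
    (hA0 : A 0 = {(0, 0)})
    (hA : ∀ n, A (n + 1) = nextGen (growth H n * H n ≤ H 0) (ch n) (A n)) (n : ℕ) :
    (A n).card = growth H n := by
  induction n with
  | zero => simp [hA0, growth]
  | succ n ih =>
    have hcast : ((A (n + 1)).card : ℝ) = growth H (n + 1) := by
      rw [Finset.cast_card, hA]
      by_cases hf : growth H n * H n ≤ H 0
      · rw [sum_nextGen_of_full hf]
        simp only [growth, if_pos hf, Finset.sum_const, Finset.card_univ, ih]
        simp [mul_comm]
      · rw [sum_nextGen_of_not_full hf]
        simp [growth, hf, ih]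
    exact_mod_cast hcast

end

theorem statement2 (k : ℕ) (h : ℝ → ℝ)
    (hpos : ∀ t : ℝ, 0 < t → 0 < h t)
    (hmono : ∀ s t : ℝ, 0 < s → s ≤ t → h s ≤ h t)
    (hcont : ContinuousOn h (Set.Ioi 0))
    (hlim : Filter.Tendsto h (nhdsWithin 0 (Set.Ioi 0)) (nhds 0))
    (hdoub : ∀ t : ℝ, 0 < t → h (2 * t) ≤ 4 * h t)
    (hint : IntegrableOn
      (fun t => t⁻¹ * |Real.log t| * Real.sqrt (t⁻¹ * h t))
      (Set.Ioo 0 1) volume) :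
    ∃ (A : Set (Pt 2)) (C : ℝ), 0 < C ∧ IsCompact A ∧
      (∀ n : ℕ, ∃ F : Finset (Pt 2),
        (F.card : ℝ) ≤ C / h ((2 : ℝ) ^ (-(n : ℤ))) ∧
        A ⊆ ⋃ x ∈ F, Metric.closedBall x ((2 : ℝ) ^ (-(n : ℤ)))) ∧
      0 < gMeasure h A ∧ gMeasure h A < ⊤ ∧
      (∀ B : Set (Pt 2), B ⊆ A → MeasurableSet B → 0 < gMeasure h B →
        ¬ PkTubeNull k B) ∧
      ¬ PkTubeNull k A := by
  classical
  set H : ℕ → ℝ := fun n => h ((2 ^ n)⁻¹) with hH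
  have h0 : ∀ n, 0 < H n := fun n => hpos _ (by positivity)
  have h1 : ∀ n, H (n + 1) ≤ H n := fun n => hmono _ _ (by positivity) (by gcongr <;> norm_num)
  have h4 : ∀ n, H n ≤ 4 * H (n + 1) := fun n => by
    have := hdoub (2 ^ (n + 1))⁻¹ (by positivity)
    have e : (2 : ℝ) * (2 ^ (n + 1))⁻¹ = (2 ^ n)⁻¹ := by rw [pow_succ]; field_simp
    rwa [e] at this
  have hg : ∀ n, (0 : ℝ) < growth H n := fun n => by exact_mod_cast growth_pos H n
  have hgen := exists_generations k (fun n => growth H n * H n ≤ H 0)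
    (fun n => 2 ^ n / growth H n) ?_ ?_ ?_ ?_
    (summable_sqrt_growth h0 h1 h4 (summable_of_integrableOn hpos hmono hint))
  · obtain ⟨ch, A, M, hA0, hA, hM⟩ := hgen
    have hcard := card_eq_growth hA0 hA
    have hlo : ∀ m, H 0 / 4 ≤ (A m).card * h ((2 ^ m)⁻¹) := fun m => by
      rw [hcard]
      linarith [(growth_bounds h0 h1 h4 m).1]
    have hup : ∀ m, (A m).card * h ((2 ^ m)⁻¹) ≤ 4 * H 0 := fun m => by
      rw [hcard]
      exact (growth_bounds h0 h1 h4 m).2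
    obtain ⟨K, hK0, hK⟩ := exists_codedMeasure_tube_le hA0 hA
      (fun n => div_pos (pow_pos two_pos n) (hg n))
      (fun n => by rw [hcard, div_mul_cancel₀ _ (hg n).ne']) hM
    set E := codedSet (fun n => (growth H n : ℝ) * H n ≤ H 0) ch with hE
    have hEpos : 0 < gMeasure h E := by
      refine lt_of_lt_of_le ?_ (codedMeasure_le_gMeasure hA0 hA (c := H 0 / 4)
        (by linarith [h0 0]) hmono hdoub hlim hlo E)
      rw [Measure.smul_apply, hE, codedMeasure_codedSet, smul_eq_mul, mul_one,
        ENNReal.ofReal_pos]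
      linarith [h0 0]
    have hnull : ∀ B : Set (Pt 2), B ⊆ E → MeasurableSet B → 0 < gMeasure h B →
        ¬ PkTubeNull k B := fun B hBE _ hB hBnull =>
      hB.ne' (gMeasure_eq_zero hA0 hA hdoub hup hBE
        (codedMeasure_eq_zero_of_pkTubeNull hK0 hK hBnull))
    refine ⟨E, 16 * H 0, by linarith [h0 0], isCompact_codedSet, fun n => ?_, hEpos, ?_, hnull,
      hnull E subset_rfl isCompact_codedSet.measurableSet hEpos⟩
    · have e : (2 : ℝ) ^ (-(n : ℤ)) = (2 ^ n)⁻¹ := by rw [zpow_neg, zpow_natCast]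
      rw [e]
      refine ⟨(A (n + 1)).image (corner (n + 1)), ?_, ?_⟩
      · rw [le_div_iff₀ (h0 n)]
        calc (((A (n + 1)).image (corner (n + 1))).card : ℝ) * H n
            ≤ (A (n + 1)).card * (4 * H (n + 1)) := by
              gcongr
              · exact (h0 n).le
              · exact Finset.card_image_le
              · exact h4 n
          _ ≤ _ := by linarith [hup (n + 1)]
      · have := codedSet_subset hA0 hA (n + 1)
        have e2 : (2 : ℝ) / 2 ^ (n + 1) = (2 ^ n)⁻¹ := by rw [pow_succ]; field_simp
        rwa [e2] at this
    · have := gMeasure_image_le hA0 hA hdoub hup 0 univ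
      simp only [mem_univ, ofPred_true, image_univ, measure_univ, mul_one] at this
      exact this.trans_lt ENNReal.ofReal_lt_top
  · simp [growth]
  · exact fun n => div_pos (pow_pos two_pos n) (hg n)
  · intro n hn
    have := (hg n).ne'
    simp only [growth, hn, if_true]
    push_cast
    field_simp
    ring
  · intro n hn
    simp only [growth, hn, if_false]
    ring
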